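/- arXiv:2308.14302 — 6 statements merged into one kernel-verified Lean document; each statement's English description precedes it below -/
import Mathlib

section
/- The free group F₂ on two generators has infinitely many characteristic subgroups N such that the quotient F₂/N is a finite simple group; that is, the set of characteristic subgroups N of F₂ for which F₂/N is a finite simple group is infinite. -/
namespace FreeGroup

variable {α : Type*} [DecidableEq α]

/-- The length of the longest common prefix of two lists. -/
def commonPrefixLength {β : Type*} [DecidableEq β] : List β → List β → ℕ
  | a :: l, b :: m => if a = b then commonPrefixLength l m + 1 else 0
  | _, _ => 0

theorem le_commonPrefixLength_iff {β : Type*} [DecidableEq β] (k : ℕ) (l m : List β) :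
    k ≤ commonPrefixLength l m ↔ k ≤ l.length ∧ k ≤ m.length ∧ l.take k = m.take k := by
  induction l generalizing k m with
  | nil => cases m <;> simp +contextual [commonPrefixLength]
  | cons a l ih =>
    cases m with
    | nil => simp [commonPrefixLength]; intro h; simp [h]
    | cons b m =>
      cases k with
      | zero => simp
      | succ k =>
        by_cases hab : a = b
        · simp [commonPrefixLength, hab, ih]
        · simp [commonPrefixLength, hab]

theorem norm_mk_of_isReduced {l : List (α × Bool)} (h : IsReduced l) : norm (mk l) = l.length := by
  rw [norm, toWord_mk, h.reduce_eq]

theorem norm_inv_mk_mul_mk (l m : List (α × Bool)) (hl : IsReduced l) (hm : IsReduced m) :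
    norm ((mk l)⁻¹ * mk m) + 2 * commonPrefixLength l m = l.length + m.length := by
  induction l generalizing m with
  | nil => simp [commonPrefixLength, ← one_eq_mk, norm_mk_of_isReduced hm]
  | cons a l ih =>
    cases m with
    | nil =>
      simp only [commonPrefixLength, ← one_eq_mk, mul_one, norm_inv_eq, norm_mk_of_isReduced hl]
      simp
    | cons b m =>
      by_cases hab : a = b
      · subst hab
        have hl' : IsReduced l := List.IsChain.tail hl
        have hm' : IsReduced m := List.IsChain.tail hm
        have := ih m hl' hm'
        have e : (mk (a :: l))⁻¹ * mk (a :: m) = (mk l)⁻¹ * mk m := by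
          rw [← List.singleton_append, ← List.singleton_append (l := m), ← mul_mk, ← mul_mk]
          group
        rw [e]
        simp only [commonPrefixLength, if_true, List.length_cons]
        omega
      · have hred : IsReduced (invRev (a :: l) ++ b :: m) := by
          have h1 : IsReduced (invRev (a :: l)) := by
            rw [isReduced_iff_reduce_eq, reduce_invRev, hl.reduce_eq]
          refine List.isChain_append.2 ⟨h1, hm, ?_⟩
          intro x hx y hy
          have hx' : x = (a.1, !a.2) := by simpa [invRev, eq_comm] using hx
          have hy' : y = b := by simpa [eq_comm] using hy
          subst hx' hy'
          intro h1
          by_contra h2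
          exact hab (Prod.ext h1 (by revert h2; cases a.2 <;> cases y.2 <;> simp))
        rw [inv_mk, mul_mk, norm_mk_of_isReduced hred]
        simp [commonPrefixLength, hab]

/-- The length of the longest common prefix of two elements of a free group, i.e. their Gromov
product in the Cayley tree. -/
def gromov (x y : FreeGroup α) : ℕ := commonPrefixLength x.toWord y.toWord

theorem norm_inv_mul_add_gromov (x y : FreeGroup α) :
    norm (x⁻¹ * y) + 2 * gromov x y = norm x + norm y := by
  have := norm_inv_mk_mul_mk x.toWord y.toWord isReduced_toWord isReduced_toWord
  rwa [mk_toWord, mk_toWord] at this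

theorem le_gromov_iff (k : ℕ) (x y : FreeGroup α) :
    k ≤ gromov x y ↔ k ≤ norm x ∧ k ≤ norm y ∧ x.toWord.take k = y.toWord.take k :=
  le_commonPrefixLength_iff k _ _

theorem gromov_comm (x y : FreeGroup α) : gromov x y = gromov y x :=
  eq_of_forall_le_iff fun k ↦ by
    rw [le_gromov_iff, le_gromov_iff, and_left_comm, eq_comm (a := x.toWord.take k)]

theorem min_gromov_le (x y z : FreeGroup α) : min (gromov x y) (gromov y z) ≤ gromov x z := by
  obtain ⟨h1, -, h2⟩ := (le_gromov_iff _ x y).1 (min_le_left (gromov x y) (gromov y z))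
  obtain ⟨-, h3, h4⟩ := (le_gromov_iff _ y z).1 (min_le_right (gromov x y) (gromov y z))
  exact (le_gromov_iff _ _ _).2 ⟨h1, h3, h2.trans h4⟩

theorem two_mul_gromov_inv_lt (x : FreeGroup α) (hx : x ≠ 1) : 2 * gromov x x⁻¹ < norm x := by
  by_contra! hlt
  have hpos : 0 < norm x := Nat.pos_of_ne_zero fun h ↦ hx (norm_eq_zero.1 h)
  obtain ⟨h1, -, h2⟩ := (le_gromov_iff _ x x⁻¹).1 le_rfl
  set w := x.toWord with hw
  have hn : w.length = norm x := rfl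
  have hred : IsReduced w := isReduced_toWord
  have key (i : ℕ) (hi : i < gromov x x⁻¹) (hi' : i < w.length) :
      w[i] = ((w[w.length - 1 - i]).1, !(w[w.length - 1 - i]).2) := by
    have := congrArg (fun l ↦ l[i]?) h2
    simp only [toWord_inv, List.getElem?_take, hi, if_true, ← hw] at this
    rw [List.getElem?_eq_getElem hi', List.getElem?_eq_getElem (by simpa using hi')] at this
    simpa [invRev] using this
  rcases Nat.even_or_odd' (norm x) with ⟨m, hm | hm⟩
  · have hi : m - 1 + 1 < w.length := by omega
    have h3 := key (m - 1) (by omega) (by omega)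
    have h4 : w.length - 1 - (m - 1) = m - 1 + 1 := by omega
    simp only [h4] at h3
    have := List.isChain_iff_getElem.1 hred (m - 1) hi
    simp [h3] at this
  · have h3 := key m (by omega) (by omega)
    have h4 : w.length - 1 - m = m := by omega
    simp only [h4] at h3
    have := congrArg Prod.snd h3
    simp at this

theorem exists_norm_eq_and_gromov_eq (x : FreeGroup α) (h : ℕ) (hh : h ≤ norm x) :
    ∃ q : FreeGroup α, norm q = h ∧ gromov q x = h := by
  have hred : IsReduced (x.toWord.take h) := List.IsChain.take isReduced_toWord h
  have hq : (mk (x.toWord.take h)).toWord = x.toWord.take h := by rw [toWord_mk, hred.reduce_eq]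
  have hn : norm (mk (x.toWord.take h)) = h := by
    rw [norm, hq, List.length_take]; exact min_eq_left hh
  refine ⟨mk (x.toWord.take h), hn, le_antisymm ?_ ?_⟩
  · exact ((le_gromov_iff _ _ _).1 le_rfl).1.trans_eq hn
  · rw [le_gromov_iff, hn, hq]; simpa using hh

/-- The amount of cancellation in the product of two elements. -/
def cancellation (x y : FreeGroup α) : ℕ := gromov x⁻¹ y

theorem norm_mul_add_cancellation (x y : FreeGroup α) :
    norm (x * y) + 2 * cancellation x y = norm x + norm y := by
  simpa [cancellation] using norm_inv_mul_add_gromov x⁻¹ y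

end FreeGroup

namespace FreeGroup

variable {α : Type*} [DecidableEq α]

/-- The family `y` of images of letters under `f` is Nielsen reduced. -/
structure IsNielsenReduced {β : Type*} (y : β × Bool → FreeGroup α) : Prop where
  pos : ∀ l, 0 < norm (y l)
  two_mul_cancellation_le : ∀ l m, (l.1 = m.1 → l.2 = m.2) →
    2 * cancellation (y l) (y m) ≤ norm (y l) ∧ 2 * cancellation (y l) (y m) ≤ norm (y m)
  cancellation_add_lt : ∀ l m k, (l.1 = m.1 → l.2 = m.2) → (m.1 = k.1 → m.2 = k.2) →
    cancellation (y l) (y m) + cancellation (y m) (y k) < norm (y m)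

theorem cancellation_mul_eq (x y z : FreeGroup α)
    (h : cancellation x y + cancellation y z < norm y) :
    cancellation x (y * z) = cancellation x y := by
  have h1 := norm_inv_mul_add_gromov y (y * z)
  rw [inv_mul_cancel_left] at h1
  have h2 := norm_mul_add_cancellation y z
  have h3 := min_gromov_le x⁻¹ y (y * z)
  have h4 := min_gromov_le x⁻¹ (y * z) y
  rw [gromov_comm (y * z) y] at h4
  unfold cancellation at *
  omega

theorem IsNielsenReduced.cons {β : Type*} {y : β × Bool → FreeGroup α} (hy : IsNielsenReduced y)
    (l : β × Bool) (L : List (β × Bool)) (hL : IsReduced (l :: L)) :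
    (∀ m, (m.1 = l.1 → m.2 = l.2) →
      cancellation (y m) (((l :: L).map y).prod) = cancellation (y m) (y l)) ∧
    ∀ m ∈ l :: L, norm (y m) ≤ norm (((l :: L).map y).prod) := by
  induction L generalizing l with
  | nil => simp
  | cons k L ih =>
    obtain ⟨hlk, hkL⟩ := List.isChain_cons_cons.1 hL
    obtain ⟨ih1, ih2⟩ := ih k hkL
    have hc := ih1 l hlk
    rw [List.map_cons, List.prod_cons]
    have hn := norm_mul_add_cancellation (y l) ((k :: L).map y).prod
    have hle := hy.two_mul_cancellation_le l k hlk
    refine ⟨fun m hm ↦ cancellation_mul_eq _ _ _ ?_, fun m hm ↦ ?_⟩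
    · rw [hc]; exact hy.cancellation_add_lt m l k hm hlk
    · have hk := ih2 k List.mem_cons_self
      rcases List.mem_cons.1 hm with rfl | hm
      · omega
      · have := ih2 m hm
        omega

theorem map_eq_prod_map_toWord {β : Type*} [DecidableEq β] {G : Type*} [Group G]
    (f : FreeGroup β →* G) (w : FreeGroup β) : f w = (w.toWord.map fun l ↦ f (mk [l])).prod := by
  conv_lhs => rw [← mk_toWord (x := w)]
  induction w.toWord with
  | nil => simp [← one_eq_mk]
  | cons a L ih => rw [← List.singleton_append, ← mul_mk, _root_.map_mul, ih]; simp

theorem IsNielsenReduced.norm_le {β : Type*} [DecidableEq β] (f : FreeGroup β →* FreeGroup α)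
    (hf : IsNielsenReduced fun l ↦ f (FreeGroup.mk [l])) (w : FreeGroup β) (l : β × Bool)
    (hl : l ∈ w.toWord) : norm (f (FreeGroup.mk [l])) ≤ norm (f w) := by
  rw [map_eq_prod_map_toWord f w]
  have hred : IsReduced w.toWord := isReduced_toWord
  generalize w.toWord = L at *
  cases L with
  | nil => simp at hl
  | cons a L => exact (hf.cons a L hred).2 l hl

theorem norm_conj_add_lt (x y : FreeGroup α) (hy : y ≠ 1)
    (h1 : 2 * cancellation x y = norm y) (h2 : 2 * cancellation y x = norm y)
    (hle : norm y ≤ norm x) :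
    ∃ q : FreeGroup α, norm (q⁻¹ * (x * y) * q) + norm (q⁻¹ * y * q) < norm x + norm y := by
  have hpos : 0 < norm y := Nat.pos_of_ne_zero fun h ↦ hy (norm_eq_zero.1 h)
  obtain ⟨q, hq, hqy⟩ := exists_norm_eq_and_gromov_eq y⁻¹ (cancellation y x)
    (by rw [norm_inv_eq]; omega)
  have hqx : cancellation y x ≤ gromov q x := by
    have := min_gromov_le q y⁻¹ x
    rw [hqy] at this
    simpa [cancellation] using this
  have hqx' : gromov q x ≤ norm q := ((le_gromov_iff _ _ _).1 le_rfl).1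
  set h := cancellation y x with hh
  -- `p = y * q` is the first half of `y`
  have hp : norm (y * q) = h := by
    have := norm_inv_mul_add_gromov q y⁻¹
    rw [← mul_inv_rev, norm_inv_eq, norm_inv_eq] at this
    omega
  have hyp : gromov y (y * q) = h := by
    have := norm_inv_mul_add_gromov y (y * q)
    rw [inv_mul_cancel_left] at this
    omega
  have hxp : h ≤ gromov x⁻¹ (y * q) := by
    have := min_gromov_le x⁻¹ y (y * q)
    rw [hyp] at this
    unfold cancellation at *
    omega
  have hqx2 := norm_inv_mul_add_gromov q x
  have hxq := norm_inv_mul_add_gromov (x⁻¹ * q) x⁻¹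
  have e1 : (x⁻¹ * q)⁻¹ * x⁻¹ = q⁻¹ := by group
  have e2 : x⁻¹ * q = (q⁻¹ * x)⁻¹ := by group
  rw [e1, e2, norm_inv_eq, norm_inv_eq, norm_inv_eq] at hxq
  have h5 := min_gromov_le (q⁻¹ * x)⁻¹ x⁻¹ (y * q)
  have h6 := norm_mul_add_cancellation (q⁻¹ * x) (y * q)
  have h7 := norm_mul_le q⁻¹ (y * q)
  rw [norm_inv_eq] at h7
  refine ⟨q, ?_⟩
  have e3 : q⁻¹ * (x * y) * q = q⁻¹ * x * (y * q) := by group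
  have e4 : q⁻¹ * y * q = q⁻¹ * (y * q) := by group
  rw [e3, e4]
  unfold cancellation at h6
  omega

end FreeGroup

namespace FreeGroup

/-- The two generators of the free group of rank two, and their inverses. -/
abbrev letter (l : Fin 2 × Bool) : FreeGroup (Fin 2) := mk [l]

theorem letter_not (i : Fin 2) (b : Bool) : letter (i, !b) = (letter (i, b))⁻¹ := by
  simp [letter, inv_mk, invRev]

/-- The automorphism exchanging the two generators. -/
def swapAut : MulAut (FreeGroup (Fin 2)) := freeGroupCongr (Equiv.swap 0 1)

/-- The automorphism inverting the first generator and fixing the second. -/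
def invAut : MulAut (FreeGroup (Fin 2)) :=
  MonoidHom.toMulEquiv (lift ![(of 0)⁻¹, of 1]) (lift ![(of 0)⁻¹, of 1])
    (by ext i; fin_cases i <;> simp) (by ext i; fin_cases i <;> simp)

/-- The automorphism multiplying the first generator by the second on the right. -/
def mulAut : MulAut (FreeGroup (Fin 2)) :=
  MonoidHom.toMulEquiv (lift ![of 0 * of 1, of 1]) (lift ![of 0 * (of 1)⁻¹, of 1])
    (by ext i; fin_cases i <;> simp) (by ext i; fin_cases i <;> simp)

@[simp] theorem swapAut_of (i : Fin 2) : swapAut (of i) = of (Equiv.swap 0 1 i) := by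
  simp [swapAut]

@[simp] theorem invAut_of_zero : invAut (of 0) = (of 0)⁻¹ := by
  simp [invAut, MonoidHom.toMulEquiv]

@[simp] theorem invAut_of_one : invAut (of 1) = of 1 := by
  simp [invAut, MonoidHom.toMulEquiv]

@[simp] theorem mulAut_of_zero : mulAut (of 0) = of 0 * of 1 := by
  simp [mulAut, MonoidHom.toMulEquiv]

@[simp] theorem mulAut_of_one : mulAut (of 1) = of 1 := by
  simp [mulAut, MonoidHom.toMulEquiv]

/-- A subgroup of `Aut F₂` containing the elementary Nielsen moves and the inner
automorphisms. -/
structure ContainsNielsen (S : Subgroup (MulAut (FreeGroup (Fin 2)))) : Prop where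
  conj_mem : ∀ g, MulAut.conj g ∈ S
  swap_mem : swapAut ∈ S
  inv_mem : invAut ∈ S
  mul_mem : mulAut ∈ S

variable {S : Subgroup (MulAut (FreeGroup (Fin 2)))}

theorem letter_true (i : Fin 2) : letter (i, true) = of i := rfl

theorem letter_false (i : Fin 2) : letter (i, false) = (of i)⁻¹ := letter_not i true

theorem ContainsNielsen.exists_signedPerm (hS : ContainsNielsen S) (l m : Fin 2 × Bool)
    (h : l.1 ≠ m.1) : ∃ π ∈ S, π (of 0) = letter l ∧ π (of 1) = letter m := by
  have hs := hS.swap_mem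
  have hi := hS.inv_mem
  obtain ⟨i, b⟩ := l
  obtain ⟨j, c⟩ := m
  have h01 (b c : Bool) : ∃ π ∈ S, π (of 0) = letter (0, b) ∧ π (of 1) = letter (1, c) := by
    have hi' : swapAut * invAut * swapAut ∈ S := S.mul_mem (S.mul_mem hs hi) hs
    cases b <;> cases c
    · exact ⟨_, S.mul_mem hi hi', by simp [letter_false], by simp [letter_false]⟩
    · exact ⟨_, hi, by simp [letter_false], by simp [letter_true]⟩
    · exact ⟨_, hi', by simp [letter_true], by simp [letter_false]⟩
    · exact ⟨1, S.one_mem, rfl, rfl⟩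
  fin_cases i <;> fin_cases j
  · simp at h
  · exact h01 b c
  · obtain ⟨π, hπ, h0, h1⟩ := h01 c b
    exact ⟨π * swapAut, S.mul_mem hπ hs, by simpa using h1, by simpa using h0⟩
  · simp at h

theorem ContainsNielsen.exists_transvection (hS : ContainsNielsen S) (l m : Fin 2 × Bool)
    (h : l.1 ≠ m.1) :
    ∃ β ∈ S, β (letter l) = letter l * letter m ∧ β (letter m) = letter m := by
  obtain ⟨π, hπ, h0, h1⟩ := hS.exists_signedPerm l m h
  refine ⟨π * mulAut * π⁻¹, S.mul_mem (S.mul_mem hπ hS.mul_mem) (S.inv_mem hπ), ?_, ?_⟩ <;>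
  simp [← h0, ← h1]

/-- The total length of the images of the generators. -/
def totalNorm (φ : MulAut (FreeGroup (Fin 2))) : ℕ := norm (φ (of 0)) + norm (φ (of 1))

theorem norm_map_letter (φ : MulAut (FreeGroup (Fin 2))) (l : Fin 2 × Bool) :
    norm (φ (letter l)) = norm (φ (of l.1)) := by
  obtain ⟨i, b⟩ := l
  cases b
  · rw [letter_false, _root_.map_inv, norm_inv_eq]
  · rfl

theorem totalNorm_eq (φ : MulAut (FreeGroup (Fin 2))) (l m : Fin 2 × Bool) (h : l.1 ≠ m.1) :
    totalNorm φ = norm (φ (letter l)) + norm (φ (letter m)) := by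
  rw [norm_map_letter, norm_map_letter, totalNorm]
  obtain ⟨i, b⟩ := l
  obtain ⟨j, c⟩ := m
  fin_cases i <;> fin_cases j <;> simp_all [add_comm]

theorem ContainsNielsen.isNielsenReduced (hS : ContainsNielsen S)
    (φ : MulAut (FreeGroup (Fin 2)))
    (hmin : ∀ β ∈ S, ∀ γ ∈ S, totalNorm φ ≤ totalNorm (γ * φ * β)) :
    IsNielsenReduced fun l ↦ φ (letter l) := by
  have hne (l) : φ (letter l) ≠ 1 := by
    rw [Ne, ← norm_eq_zero, norm_map_letter, norm_eq_zero]
    simp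
  have hnorm (l : Fin 2 × Bool) : norm (φ (letter (l.1, !l.2))) = norm (φ (letter l)) := by
    rw [letter_not, _root_.map_inv, norm_inv_eq]
  have hself (l) : 2 * cancellation (φ (letter l)) (φ (letter l)) < norm (φ (letter l)) := by
    have := two_mul_gromov_inv_lt _ (hne l)
    rwa [cancellation, gromov_comm]
  have hleft (l m : Fin 2 × Bool) (h : l.1 ≠ m.1) :
      norm (φ (letter l)) ≤ norm (φ (letter l) * φ (letter m)) := by
    obtain ⟨β, hβ, h1, h2⟩ := hS.exists_transvection l m h
    have := hmin β hβ 1 S.one_mem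
    rw [totalNorm_eq _ l m h, totalNorm_eq _ l m h] at this
    simp only [one_mul, MulAut.mul_apply, h1, h2, _root_.map_mul] at this
    omega
  have hright (l m : Fin 2 × Bool) (h : l.1 ≠ m.1) :
      norm (φ (letter m)) ≤ norm (φ (letter l) * φ (letter m)) := by
    have := hleft (m.1, !m.2) (l.1, !l.2) h.symm
    rwa [hnorm, letter_not, letter_not, _root_.map_inv, _root_.map_inv, ← mul_inv_rev,
      norm_inv_eq] at this
  have hle (l m : Fin 2 × Bool) (h : l.1 = m.1 → l.2 = m.2) :
      2 * cancellation (φ (letter l)) (φ (letter m)) ≤ norm (φ (letter l)) ∧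
      2 * cancellation (φ (letter l)) (φ (letter m)) ≤ norm (φ (letter m)) := by
    by_cases hlm : l.1 = m.1
    · obtain rfl : l = m := Prod.ext hlm (h hlm)
      exact ⟨(hself l).le, (hself l).le⟩
    · have h1 := hleft l m hlm
      have h2 := hright l m hlm
      have := norm_mul_add_cancellation (φ (letter l)) (φ (letter m))
      omega
  refine ⟨fun l ↦ Nat.pos_of_ne_zero fun h ↦ hne l (norm_eq_zero.1 h), hle,
    fun l m k hlm hmk ↦ ?_⟩
  by_contra! hlt
  have h1 := hle l m hlm
  have h2 := hle m k hmk
  have hs := hself m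
  have hlm' : l.1 ≠ m.1 := fun h ↦ by
    obtain rfl : l = m := Prod.ext h (hlm h)
    omega
  have hmk' : m.1 ≠ k.1 := fun h ↦ by
    obtain rfl : m = k := Prod.ext h (hmk h)
    omega
  have hlk : l.1 = k.1 := by omega
  by_cases hlk' : l.2 = k.2
  · obtain rfl : l = k := Prod.ext hlk hlk'
    obtain ⟨q, hq⟩ := norm_conj_add_lt (φ (letter l)) (φ (letter m)) (hne m) (by omega) (by omega)
      (by omega)
    obtain ⟨β, hβ, hl, hm⟩ := hS.exists_transvection l m hlm'
    have := hmin β hβ _ (hS.conj_mem q⁻¹)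
    rw [totalNorm_eq _ l m hlm', totalNorm_eq _ l m hlm'] at this
    simp only [MulAut.mul_apply, hl, hm, MulAut.conj_apply, inv_inv, _root_.map_mul] at this
    rw [show ∀ x y : FreeGroup (Fin 2), q⁻¹ * x * q * (q⁻¹ * y * q) = q⁻¹ * (x * y) * q from
      fun x y ↦ by group] at this
    omega
  · obtain rfl : k = (l.1, !l.2) := Prod.ext hlk.symm (Bool.eq_not.2 (Ne.symm hlk'))
    have h3 := min_gromov_le (φ (letter m))⁻¹ (φ (letter l))⁻¹ (φ (letter m))
    have h4 : φ (letter (l.1, !l.2)) = (φ (letter l))⁻¹ := by rw [letter_not, _root_.map_inv]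
    rw [h4] at hlt h2
    unfold cancellation at *
    omega

theorem exists_eq_letter_of_norm_eq_one (x : FreeGroup (Fin 2)) (hx : norm x = 1) :
    ∃ l, x = letter l := by
  obtain ⟨l, hl⟩ := List.length_eq_one_iff.1 hx
  exact ⟨l, by rw [letter, ← hl, mk_toWord]⟩

/-- The exponent sum of the `i`-th generator. -/
def exponentSum (i : Fin 2) : FreeGroup (Fin 2) →* Multiplicative ℤ :=
  lift (Pi.mulSingle i (Multiplicative.ofAdd 1))

theorem exponentSum_eq_one (i : Fin 2) (w : FreeGroup (Fin 2)) (hw : ∀ l ∈ w.toWord, l.1 ≠ i) :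
    exponentSum i w = 1 := by
  rw [map_eq_prod_map_toWord]
  refine List.prod_eq_one fun x hx ↦ ?_
  obtain ⟨l, hl, rfl⟩ := List.mem_map.1 hx
  obtain ⟨j, b⟩ := l
  have : j ≠ i := hw _ hl
  cases b
  · change exponentSum i (letter (j, false)) = 1
    rw [letter_false]
    simp [exponentSum, this]
  · change exponentSum i (of j) = 1
    simp [exponentSum, this]

theorem norm_map_of_eq_one (φ : MulAut (FreeGroup (Fin 2)))
    (hφ : IsNielsenReduced fun l ↦ φ (letter l)) (i : Fin 2) : norm (φ (of i)) = 1 := by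
  obtain ⟨j, l, hl, hi⟩ : ∃ j : Fin 2, ∃ l ∈ (φ.symm (of j)).toWord, l.1 = i := by
    by_contra! h
    have h1 : (exponentSum i).comp φ.symm.toMonoidHom = 1 := by
      ext j
      exact congrArg _ (exponentSum_eq_one i _ (h j))
    have h2 := DFunLike.congr_fun h1 (φ (of i))
    simp [exponentSum] at h2
  have h1 := IsNielsenReduced.norm_le φ.toMonoidHom hφ _ l hl
  have h2 := hφ.pos l
  simp only [MulEquiv.toMonoidHom_eq_coe, MonoidHom.coe_coe, MulEquiv.apply_symm_apply,
    norm_of] at h1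
  have h3 := norm_map_letter φ l
  rw [hi] at h3
  simp only [letter] at h2 h3
  omega

/-- **Nielsen's theorem** in rank two: the elementary Nielsen moves together with the inner
automorphisms generate `Aut F₂`. -/
theorem ContainsNielsen.eq_top (hS : ContainsNielsen S) : S = ⊤ := by
  by_contra hne
  obtain ⟨φ₀, hφ₀⟩ : ∃ φ, ¬φ ∈ S := by
    by_contra! h
    exact hne ((Subgroup.eq_top_iff' S).2 h)
  obtain ⟨φ, hφ, hmin⟩ := exists_minimalFor_of_wellFoundedLT (· ∉ S) totalNorm ⟨φ₀, hφ₀⟩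
  have hred := hS.isNielsenReduced φ fun β hβ γ hγ ↦ by
    have : γ * φ * β ∉ S := fun h ↦ hφ ((S.mul_mem_cancel_left hγ).1
      ((S.mul_mem_cancel_right hβ).1 h))
    exact (le_total _ _).elim id (hmin this)
  obtain ⟨l, hl⟩ := exists_eq_letter_of_norm_eq_one _ (norm_map_of_eq_one φ hred 0)
  obtain ⟨m, hm⟩ := exists_eq_letter_of_norm_eq_one _ (norm_map_of_eq_one φ hred 1)
  have hlm : l.1 ≠ m.1 := by
    intro h
    obtain ⟨i, b⟩ := l
    obtain ⟨j, c⟩ := m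
    obtain rfl : i = j := h
    have : φ (of 0) = φ (of 1) ∨ φ (of 0) = φ (of 1)⁻¹ := by
      rw [_root_.map_inv, hl, hm]
      cases b <;> cases c <;> simp [letter_true, letter_false]
    rcases this with h | h <;> have := congrArg (exponentSum 0) (φ.injective h) <;>
      simp [exponentSum] at this
  obtain ⟨π, hπ, h0, h1⟩ := hS.exists_signedPerm l m hlm
  have : φ = π := by
    apply MulEquiv.toMonoidHom_injective
    ext i
    fin_cases i
    · exact hl.trans h0.symm
    · exact hm.trans h1.symm
  exact hφ (this ▸ hπ)

end FreeGroup

section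

open Matrix Matrix.SpecialLinearGroup
open scoped MatrixGroups LinearAlgebra.Projectivization commutatorElement

namespace Matrix.SpecialLinearGroup

variable {F : Type*} [Field F]

theorem diag2n_eq_transvection_prod {ι : Type*} [Fintype ι] [DecidableEq ι] {i j : ι}
    (hij : i ≠ j) {a : F} (ha : a ≠ 0) :
    diag2n hij a ha = SpecialLinearGroup.transvection hij a *
      SpecialLinearGroup.transvection hij.symm (-a⁻¹) *
      SpecialLinearGroup.transvection hij a *
      SpecialLinearGroup.transvection hij (-1) *
      SpecialLinearGroup.transvection hij.symm 1 *
      SpecialLinearGroup.transvection hij (-1) := by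
  have hD : (diag2n hij a ha).1 = 1 + single i i (a - 1) + single j j (a⁻¹ - 1) := by
    ext k l
    simp only [diag2n_coe, diagonal_apply, Matrix.add_apply, one_apply, single_apply]
    grind
  refine Subtype.ext (hD.trans ?_)
  simp only [coe_mul, transvection_coe, mul_add, add_mul, mul_one, one_mul, single_mul_single_same,
    single_mul_single_of_ne _ _ _ _ hij, single_mul_single_of_ne _ _ _ _ hij.symm, add_zero,
    mul_neg, neg_mul, mul_inv_cancel₀ ha, inv_mul_cancel₀ ha, neg_neg]
  simp only [← single_neg, sub_eq_add_neg, single_add]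
  abel

theorem eq_top_of_transvection_mem {H : Subgroup SL(3, F)}
    (h : ∀ (i j : Fin 3) (hij : i ≠ j) (c : F), SpecialLinearGroup.transvection hij c ∈ H) :
    H = ⊤ := by
  refine eq_top_iff.2 fun M _ ↦ diagonal_transvection_induction' (· ∈ H) M
    (fun i j hij c hc ↦ ?_) h fun _ _ ↦ mul_mem
  rw [diag2n_eq_transvection_prod]
  exact mul_mem (mul_mem (mul_mem (mul_mem (mul_mem (h _ _ _ _) (h _ _ _ _)) (h _ _ _ _))
    (h _ _ _ _)) (h _ _ _ _)) (h _ _ _ _)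

theorem commutatorElement_transvection {ι : Type*} [Fintype ι] [DecidableEq ι] {i j k : ι}
    (hik : i ≠ k) (hkj : k ≠ j) (hij : i ≠ j) (c : F) :
    ⁅SpecialLinearGroup.transvection hik c, SpecialLinearGroup.transvection hkj 1⁆ =
      SpecialLinearGroup.transvection hij c := by
  rw [commutatorElement_def, mul_inv_eq_iff_eq_mul, mul_inv_eq_iff_eq_mul]
  refine Subtype.ext ?_
  simp only [coe_mul, transvection_coe, mul_add, add_mul, mul_one, one_mul, single_mul_single_same,
    single_mul_single_of_ne _ _ _ _ hij.symm, single_mul_single_of_ne _ _ _ _ hkj.symm,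
    add_zero]
  abel

instance isPerfect_three : Group.IsPerfect SL(3, F) where
  commutator_eq_top := eq_top_of_transvection_mem fun i j hij c ↦ by
    obtain ⟨k, hik, hkj⟩ : ∃ k, i ≠ k ∧ k ≠ j := by revert i j; decide
    rw [← commutatorElement_transvection hik hkj hij c]
    exact Subgroup.commutator_mem_commutator (Subgroup.mem_top _) (Subgroup.mem_top _)

theorem iSup_lineStab_eq_top :
    (⨆ p : ℙ F (Fin 3 → F), lineStab p.submodule) = (⊤ : Subgroup SL(3, F)) := by
  refine eq_top_of_transvection_mem fun i j hij c ↦ ?_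
  have h := SL2Gen.transvection_mem_lineStab hij c
  rw [← Projectivization.submodule_mk (K := F) _ (Pi.single_ne_zero_iff.2 one_ne_zero)] at h
  exact Subgroup.mem_iSup_of_mem _ h

end Matrix.SpecialLinearGroup

namespace Matrix.ProjectiveSpecialLinearGroup

variable (F : Type*) [Field F]

/-- The Iwasawa structure on `PSL(3, F)` acting on the projective plane. -/
noncomputable def iwasawaThree :
    MulAction.IwasawaStructure (Matrix.ProjectiveSpecialLinearGroup (Fin 3) F)
      (ℙ F (Fin 3 → F)) where
  T := PSL.iwasawaT
  is_comm p := by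
    have hSL : IsMulCommutative (lineStab (F := F) (ι := Fin 3) p.submodule) := by
      rw [← Projectivization.mk_rep p, Projectivization.submodule_mk]
      exact lineStab_isMulCommutative_of_span p.rep p.rep_nonzero
    exact Subgroup.map_isMulCommutative _ _
  is_conj g p := by
    obtain ⟨g, rfl⟩ := QuotientGroup.mk_surjective g
    rw [Matrix.ProjectiveSpecialLinearGroup.smul_proj_mk]
    change Subgroup.map _ _ = _
    rw [PSL.smul_submodule, Matrix.SpecialLinearGroup.lineStab_smul, PSL.iwasawaT_map_conj]
  is_generator := by
    have h : iSup (PSL.iwasawaT (F := F) (ι := Fin 3)) =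
        Subgroup.map (QuotientGroup.mk' (Subgroup.center SL(3, F)))
          (⨆ p : ℙ F (Fin 3 → F), lineStab p.submodule) := by
      rw [Subgroup.map_iSup]
    rw [h, iSup_lineStab_eq_top]
    exact Subgroup.map_top_of_surjective _ (QuotientGroup.mk'_surjective _)

theorem isSimpleGroup_three :
    IsSimpleGroup (Matrix.ProjectiveSpecialLinearGroup (Fin 3) F) := by
  have : Group.IsPerfect (Matrix.ProjectiveSpecialLinearGroup (Fin 3) F) := inferInstance
  exact (iwasawaThree F).isSimpleGroup this.commutator_eq_top inferInstance

end Matrix.ProjectiveSpecialLinearGroup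

namespace Matrix.SpecialLinearGroup

variable {n F : Type*} [Fintype n] [DecidableEq n] [Field F]

theorem mem_center_iff_exists_scalar {g : SpecialLinearGroup n F} :
    g ∈ Subgroup.center (SpecialLinearGroup n F) ↔ ∃ r : F, scalar n r = g.1 := by
  refine mem_center_iff.trans ⟨fun ⟨r, _, hr⟩ ↦ ⟨r, hr⟩, fun ⟨r, hr⟩ ↦ ⟨r, ?_, hr⟩⟩
  rw [← g.2, ← hr, scalar_apply, det_diagonal, Finset.prod_const, Finset.card_univ]

theorem mem_center_iff_of_mul_eq_mul {g h : SpecialLinearGroup n F} {P : Matrix n n F}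
    (hP : IsUnit P) (hgh : h.1 * P = P * g.1) :
    h ∈ Subgroup.center (SpecialLinearGroup n F) ↔
      g ∈ Subgroup.center (SpecialLinearGroup n F) := by
  simp only [mem_center_iff_exists_scalar]
  refine exists_congr fun r ↦ ?_
  rw [← hP.mul_left_inj, hgh, scalar_comm r (fun s ↦ Commute.all r s), hP.mul_right_inj]

theorem transpose_mem_center_iff {g : SpecialLinearGroup n F} :
    g.transpose ∈ Subgroup.center (SpecialLinearGroup n F) ↔
      g ∈ Subgroup.center (SpecialLinearGroup n F) := by
  simp only [mem_center_iff_exists_scalar]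
  refine exists_congr fun r ↦ ?_
  rw [coe_transpose, ← transpose_inj]
  simp

/-- The contragredient of a linear representation. -/
def contragredient {G : Type*} [Group G] (ρ : G →* SpecialLinearGroup n F) :
    G →* SpecialLinearGroup n F where
  toFun x := (ρ x⁻¹).transpose
  map_one' := Subtype.ext (by simp)
  map_mul' x y := by
    rw [_root_.mul_inv_rev, map_mul]
    exact Subtype.ext (transpose_mul (ρ y⁻¹).1 (ρ x⁻¹).1)

theorem mul_eq_mul_of_forall_of {α : Type*} {ρ σ : FreeGroup α →* SpecialLinearGroup n F}
    {P : Matrix n n F}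
    (h : ∀ i, (ρ (FreeGroup.of i)).1 * P = P * (σ (FreeGroup.of i)).1) (x : FreeGroup α) :
    (ρ x).1 * P = P * (σ x).1 := by
  induction x using FreeGroup.induction_on with
  | C1 => simp
  | of i => exact h i
  | inv_of i hi =>
    rw [map_inv, map_inv]
    have h₁ : (ρ (FreeGroup.of i))⁻¹.1 * (ρ (FreeGroup.of i)).1 = 1 := by
      rw [← coe_mul, inv_mul_cancel, coe_one]
    have h₂ : (σ (FreeGroup.of i)).1 * (σ (FreeGroup.of i))⁻¹.1 = 1 := by
      rw [← coe_mul, mul_inv_cancel, coe_one]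
    calc (ρ (FreeGroup.of i))⁻¹.1 * P
        = (ρ (FreeGroup.of i))⁻¹.1 * (P * (σ (FreeGroup.of i)).1) * (σ (FreeGroup.of i))⁻¹.1 := by
          rw [mul_assoc, mul_assoc, h₂, mul_one]
      _ = P * (σ (FreeGroup.of i))⁻¹.1 := by
          rw [← h i, ← mul_assoc, h₁, one_mul]
  | mul x y hx hy =>
    rw [map_mul, map_mul, coe_mul, coe_mul, mul_assoc, hy, ← mul_assoc, hx, mul_assoc]

end Matrix.SpecialLinearGroup

namespace FreeGroup

variable {F : Type*} [Field F]

/-- The representation of `F₂` obtained from the reduced Burau representation of the braid group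
on four strands, specialised at a primitive cube root of unity, by restriction to the normal
free subgroup of rank two. -/
def burau {w : F} (hw : w ^ 2 + w + 1 = 0) : FreeGroup (Fin 2) →* SL(3, F) :=
  lift ![⟨!![-w, 1, 0; 0, 1, 0; 0, 1, 1 + w], by
      simp [det_fin_three]; grind⟩,
    ⟨!![1 - w, 1 + w, -1 - w; 2 + w, 1 + w, 0; 1, 1 + w, 0], by
      simp [det_fin_three]; grind⟩]

variable {w : F} (hw : w ^ 2 + w + 1 = 0)

theorem burau_of_zero :
    (burau hw (of 0)).1 = !![-w, 1, 0; 0, 1, 0; 0, 1, 1 + w] := by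
  simp [burau]

theorem burau_of_one : (burau hw (of 1)).1 =
    !![1 - w, 1 + w, -1 - w; 2 + w, 1 + w, 0; 1, 1 + w, 0] := by
  simp [burau]

theorem burau_of_zero_inv : (burau hw (of 0)⁻¹).1 =
    !![1 + w, -1 - w, 0; 0, 1, 0; 0, w, -w] := by
  rw [_root_.map_inv, coe_inv, burau_of_zero]
  ext i j
  fin_cases i <;> fin_cases j <;> simp [adjugate_fin_three] <;> grind

/-- The projectivisation of the representation `FreeGroup.burau`. -/
def projBurau : FreeGroup (Fin 2) →* Matrix.ProjectiveSpecialLinearGroup (Fin 3) F :=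
  (QuotientGroup.mk' _).comp (burau hw)

theorem mem_ker_projBurau {x : FreeGroup (Fin 2)} :
    x ∈ (projBurau hw).ker ↔ burau hw x ∈ Subgroup.center SL(3, F) := by
  rw [MonoidHom.mem_ker]
  exact QuotientGroup.eq_one_iff _

theorem mem_ker_projBurau_iff_of_mul_eq_mul {α : MulAut (FreeGroup (Fin 2))}
    {P : Matrix (Fin 3) (Fin 3) F} (hP : IsUnit P)
    (h : ∀ i, (burau hw (α (of i))).1 * P = P * (burau hw (of i)).1) (x : FreeGroup (Fin 2)) :
    α x ∈ (projBurau hw).ker ↔ x ∈ (projBurau hw).ker := by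
  rw [mem_ker_projBurau, mem_ker_projBurau]
  exact mem_center_iff_of_mul_eq_mul hP
    (mul_eq_mul_of_forall_of (ρ := (burau hw).comp α.toMonoidHom) (σ := burau hw) h x)

theorem mem_ker_projBurau_iff_of_mul_mul_transpose {α : MulAut (FreeGroup (Fin 2))}
    {P : Matrix (Fin 3) (Fin 3) F} (hP : IsUnit P)
    (h : ∀ i, (burau hw (α (of i))).1 * P * (burau hw (of i)).1ᵀ = P) (x : FreeGroup (Fin 2)) :
    α x ∈ (projBurau hw).ker ↔ x ∈ (projBurau hw).ker := by
  rw [mem_ker_projBurau, mem_ker_projBurau]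
  have h' (i) : ((burau hw).comp α.toMonoidHom (of i)).1 * P =
      P * (contragredient (burau hw) (of i)).1 := by
    conv_rhs => rw [← h i]
    change _ = _ * (burau hw (of i)⁻¹).1ᵀ
    rw [mul_assoc, ← transpose_mul, ← coe_mul, ← _root_.map_mul, inv_mul_cancel, _root_.map_one,
      coe_one, transpose_one, mul_one]
    rfl
  refine (mem_center_iff_of_mul_eq_mul hP (mul_eq_mul_of_forall_of h' x)).trans ?_
  change (burau hw x⁻¹).transpose ∈ _ ↔ _
  rw [transpose_mem_center_iff, _root_.map_inv, inv_mem_iff]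

theorem isUnit_of_cubeRoot (hw : w ^ 2 + w + 1 = 0) : IsUnit w :=
  IsUnit.of_mul_eq_one (-1 - w) (by linear_combination -hw)

theorem swapAut_mem_ker_projBurau_iff (x : FreeGroup (Fin 2)) :
    swapAut x ∈ (projBurau hw).ker ↔ x ∈ (projBurau hw).ker := by
  refine mem_ker_projBurau_iff_of_mul_mul_transpose hw
    (P := !![w, -1, 0; -1, -1 - 2 * w, -w; 0, -w, 1]) ?_ (fun i ↦ ?_) x
  · rw [isUnit_iff_isUnit_det, det_fin_three]
    convert isUnit_of_cubeRoot hw using 1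
    simp
    grind
  · fin_cases i
    · ext i j
      fin_cases i <;> fin_cases j <;>
        simp [burau_of_zero, burau_of_one, mul_apply, Fin.sum_univ_three] <;> grind
    · ext i j
      fin_cases i <;> fin_cases j <;>
        simp [burau_of_zero, burau_of_one, mul_apply, Fin.sum_univ_three] <;> grind

theorem invAut_mem_ker_projBurau_iff (x : FreeGroup (Fin 2)) :
    invAut x ∈ (projBurau hw).ker ↔ x ∈ (projBurau hw).ker := by
  refine mem_ker_projBurau_iff_of_mul_mul_transpose hw
    (P := !![w, -1 - w, -w; -1 - w, -w, 1; -w, 1, 1]) ?_ (fun i ↦ ?_) x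
  · rw [isUnit_iff_isUnit_det, det_fin_three]
    convert (isUnit_of_cubeRoot hw).neg using 1
    simp
    grind
  · fin_cases i
    · ext i j
      fin_cases i <;> fin_cases j <;>
        simp [burau_of_zero, burau_of_zero_inv, -_root_.map_inv, mul_apply,
          Fin.sum_univ_three] <;> grind
    · ext i j
      fin_cases i <;> fin_cases j <;>
        simp [burau_of_one, mul_apply, Fin.sum_univ_three] <;> grind

theorem mulAut_mem_ker_projBurau_iff (x : FreeGroup (Fin 2)) :
    mulAut x ∈ (projBurau hw).ker ↔ x ∈ (projBurau hw).ker := by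
  refine mem_ker_projBurau_iff_of_mul_eq_mul hw
    (P := !![1, 0, 0; w, 0, -w; w, -1, 1 - w]) ?_ (fun i ↦ ?_) x
  · rw [isUnit_iff_isUnit_det, det_fin_three]
    convert (isUnit_of_cubeRoot hw).neg using 1
    simp
  · fin_cases i
    · ext i j
      fin_cases i <;> fin_cases j <;>
        simp [burau_of_zero, burau_of_one, mul_apply, Fin.sum_univ_three] <;> grind
    · ext i j
      fin_cases i <;> fin_cases j <;>
        simp [burau_of_one, mul_apply, Fin.sum_univ_three] <;> grind

theorem characteristic_ker_projBurau : (projBurau hw).ker.Characteristic := by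
  let S : Subgroup (MulAut (FreeGroup (Fin 2))) :=
    { carrier := {α | ∀ x, α x ∈ (projBurau hw).ker ↔ x ∈ (projBurau hw).ker}
      one_mem' := fun x ↦ Iff.rfl
      mul_mem' := fun {α β} hα hβ x ↦ (hα (β x)).trans (hβ x)
      inv_mem' := fun {α} hα x ↦ by simpa using (hα (α⁻¹ x)).symm }
  have hS : ContainsNielsen S :=
    { conj_mem := fun g x ↦ by
        simp [MulAut.conj_apply, MonoidHom.mem_ker]
      swap_mem := swapAut_mem_ker_projBurau_iff hw
      inv_mem := invAut_mem_ker_projBurau_iff hw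
      mul_mem := mulAut_mem_ker_projBurau_iff hw }
  refine Subgroup.characteristic_iff_comap_eq.2 fun α ↦ Subgroup.ext fun x ↦ ?_
  have hα : α ∈ S := hS.eq_top ▸ Subgroup.mem_top α
  exact hα x

end FreeGroup

namespace Matrix.SpecialLinearGroup

variable {n F : Type*} [Fintype n] [DecidableEq n] [Field F]

/-- The subgroup `H` contains all the transvections `1 + s • v ⊗ f`. -/
def ContainsTransvections (H : Subgroup (SpecialLinearGroup n F)) (v f : n → F) : Prop :=
  ∀ s : F, ∃ g ∈ H, g.1 = 1 + s • vecMulVec v f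

namespace ContainsTransvections

variable {H : Subgroup (SpecialLinearGroup n F)} {v f v' f' : n → F}

theorem smul_left (h : ContainsTransvections H v f) (c : F) :
    ContainsTransvections H (c • v) f := fun s ↦ by
  obtain ⟨g, hg, h⟩ := h (s * c)
  exact ⟨g, hg, by rw [h, smul_vecMulVec, smul_smul]⟩

theorem smul_right (h : ContainsTransvections H v f) (c : F) :
    ContainsTransvections H v (c • f) := fun s ↦ by
  obtain ⟨g, hg, h⟩ := h (s * c)
  exact ⟨g, hg, by rw [h, vecMulVec_smul, smul_smul]⟩

theorem add_left (h : ContainsTransvections H v f) (h' : ContainsTransvections H v' f)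
    (hv' : f ⬝ᵥ v' = 0) : ContainsTransvections H (v + v') f := fun s ↦ by
  obtain ⟨g, hg, h⟩ := h s
  obtain ⟨g', hg', h'⟩ := h' s
  refine ⟨g * g', mul_mem hg hg', ?_⟩
  rw [coe_mul, h, h', add_vecMulVec, mul_add, add_mul, add_mul]
  simp [vecMulVec_mul_vecMulVec, hv', add_assoc]

theorem conj {g : SpecialLinearGroup n F} (hg : g ∈ H) (h : ContainsTransvections H v f)
    (hv : g.1 *ᵥ v = v') (hf : f' ᵥ* g.1 = f) : ContainsTransvections H v' f' := fun s ↦ by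
  obtain ⟨t, ht, h⟩ := h s
  refine ⟨g * t * g⁻¹, mul_mem (mul_mem hg ht) (inv_mem hg), ?_⟩
  have hgg : g.1 * g⁻¹.1 = 1 := by rw [← coe_mul, mul_inv_cancel, coe_one]
  have key : (g * t).1 = (1 + s • vecMulVec v' f') * g.1 := by
    rw [coe_mul, h, mul_add, add_mul, mul_one, one_mul, Matrix.mul_smul, Matrix.smul_mul,
      mul_vecMulVec, vecMulVec_mul, hv, hf]
  rw [coe_mul, key, mul_assoc, hgg, mul_one]

theorem conj_symm {g : SpecialLinearGroup n F} (hg : g ∈ H) (h : ContainsTransvections H v' f')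
    (hv : g.1 *ᵥ v = v') (hf : f' ᵥ* g.1 = f) : ContainsTransvections H v f := by
  refine h.conj (inv_mem hg) ?_ ?_
  · rw [← hv, mulVec_mulVec, ← coe_mul, inv_mul_cancel, coe_one, one_mulVec]
  · rw [← hf, vecMul_vecMul, ← coe_mul, mul_inv_cancel, coe_one, vecMul_one]

theorem conj_contains (h : ContainsTransvections H v f) (h' : ContainsTransvections H v' f')
    (hvf' : f' ⬝ᵥ v' = 0) (s : F) :
    ContainsTransvections H (v + (s * f' ⬝ᵥ v) • v') (f - (s * f ⬝ᵥ v') • f') := by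
  obtain ⟨g, hg, hgs⟩ := h' s
  refine h.conj hg ?_ ?_
  · rw [hgs, add_mulVec, one_mulVec, smul_mulVec, vecMulVec_mulVec, op_smul_eq_smul, smul_smul]
  · rw [hgs, vecMul_add, vecMul_one, vecMul_smul, vecMul_vecMulVec, smul_smul, sub_dotProduct,
      smul_dotProduct, hvf', smul_zero, sub_zero, sub_add_cancel]

theorem commutator (h : ContainsTransvections H v f) (h' : ContainsTransvections H v' f')
    (hvf : f ⬝ᵥ v = 0) (hvf' : f' ⬝ᵥ v' = 0) (h₀ : f ⬝ᵥ v' = 0) (h₁ : f' ⬝ᵥ v = 1) :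
    ContainsTransvections H v' f := fun s ↦ by
  obtain ⟨g, hg, hgs⟩ := h (-s)
  obtain ⟨k, hk, hks⟩ := h s
  obtain ⟨g', hg', hg's⟩ := h' 1
  obtain ⟨k', hk', hk's⟩ := h' (-1)
  refine ⟨g * g' * k * k', mul_mem (mul_mem (mul_mem hg hg') hk) hk', ?_⟩
  have hZ : vecMulVec v' f' * vecMulVec v f = vecMulVec v' f := by
    rw [vecMulVec_mul_vecMulVec, h₁, one_smul]
  have hXX : vecMulVec v f * vecMulVec v f = 0 := by simp [vecMulVec_mul_vecMulVec, hvf]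
  have hXY : vecMulVec v f * vecMulVec v' f' = 0 := by simp [vecMulVec_mul_vecMulVec, h₀]
  have hYY : vecMulVec v' f' * vecMulVec v' f' = 0 := by simp [vecMulVec_mul_vecMulVec, hvf']
  have hZY : vecMulVec v' f * vecMulVec v' f' = 0 := by simp [vecMulVec_mul_vecMulVec, h₀]
  simp only [coe_mul, hgs, hks, hg's, hk's, mul_add, add_mul, Matrix.mul_smul, Matrix.smul_mul,
    mul_one, one_mul, one_smul, neg_smul, mul_neg, neg_mul, hXX, hXY, hYY, hZ, hZY,
    smul_zero, neg_zero, add_zero]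
  abel

theorem of_mem {p : ℕ} [Fact p.Prime] {H : Subgroup (SpecialLinearGroup n (ZMod p))}
    {v f : n → ZMod p} {g : SpecialLinearGroup n (ZMod p)} (hg : g ∈ H)
    (h : g.1 = 1 + vecMulVec v f) (hvf : f ⬝ᵥ v = 0) : ContainsTransvections H v f := fun s ↦ by
  refine ⟨g ^ s.val, pow_mem hg _, ?_⟩
  have key (k : ℕ) : (g ^ k).1 = 1 + (k : ZMod p) • vecMulVec v f := by
    induction k with
    | zero => simp
    | succ k ih =>
      rw [pow_succ, coe_mul, ih, h, mul_add, mul_one, add_mul, one_mul, Nat.cast_add_one, add_smul,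
        Matrix.smul_mul, vecMulVec_mul_vecMulVec, hvf, zero_smul, vecMulVec_zero, smul_zero,
        add_zero, one_smul, add_assoc]
  rw [key, ZMod.natCast_zmod_val]

theorem transvection_mem {i j : n} (hij : i ≠ j)
    (h : ContainsTransvections H (Pi.single i 1) (Pi.single j 1)) (c : F) :
    SpecialLinearGroup.transvection hij c ∈ H := by
  obtain ⟨g, hg, h⟩ := h c
  convert hg using 1
  refine Subtype.ext ?_
  rw [h, transvection_coe]
  ext k l
  simp [vecMulVec_apply, single_apply, Pi.single_apply, ← ite_and, eq_comm, and_comm]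

end ContainsTransvections

end Matrix.SpecialLinearGroup

namespace FreeGroup

section
variable {F : Type*} [Field F] {w : F} (hw : w ^ 2 + w + 1 = 0)

theorem burau_commutatorElement : (burau hw ⁅(of 0 : FreeGroup (Fin 2)), of 1⁆).1 =
    !![-1 - w, 2 - 2 * w, -2 + 2 * w; 0, 3 + w, -4 - 2 * w; 0, 4 + 2 * w, -5 - 3 * w] := by
  have h : (burau hw ⁅(of 0 : FreeGroup (Fin 2)), of 1⁆).1 * (burau hw (of 1 * of 0)).1 =
      (burau hw (of 0 * of 1)).1 := by
    rw [← coe_mul, ← _root_.map_mul, commutatorElement_def]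
    congr 2
    group
  have hu : IsUnit (burau hw (of 1 * of 0)).1 := by
    rw [isUnit_iff_isUnit_det, (burau hw (of 1 * of 0)).2]
    exact isUnit_one
  rw [← hu.mul_left_inj, h, _root_.map_mul, _root_.map_mul, coe_mul, coe_mul, burau_of_zero,
    burau_of_one]
  ext i j
  fin_cases i <;> fin_cases j <;> simp [mul_apply, Fin.sum_univ_three] <;> grind

theorem burau_commutatorElement_pow_three : (burau hw (⁅(of 0 : FreeGroup (Fin 2)), of 1⁆ ^ 3)).1 =
    1 + vecMulVec ((6 + 12 * w) • ![1, 1 + w, 1 + w]) ![0, 1, -1] := by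
  rw [pow_three, _root_.map_mul, _root_.map_mul, coe_mul, coe_mul, burau_commutatorElement]
  ext i j
  fin_cases i <;> fin_cases j <;> simp [mul_apply, Fin.sum_univ_three] <;> grind

end

variable {p : ℕ} [Fact p.Prime] {w : ZMod p} (hw : w ^ 2 + w + 1 = 0)

theorem burau_range_eq_top (h6 : (6 : ZMod p) ≠ 0) : (burau hw).range = ⊤ := by
  set H := (burau hw).range
  have hA : burau hw (of 0) ∈ H := ⟨_, rfl⟩
  have hB : burau hw (of 1) ∈ H := ⟨_, rfl⟩
  have h₀ : ContainsTransvections H ![1, 1 + w, 1 + w] ![0, 1, -1] := by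
    have hC : burau hw (⁅(of 0 : FreeGroup (Fin 2)), of 1⁆ ^ 3) ∈ H := ⟨_, rfl⟩
    have hc : 6 + 12 * w ≠ 0 := fun h ↦ h6 <|
      (pow_eq_zero_iff three_ne_zero).1 (by linear_combination 288 * hw - 2 * (6 + 12 * w) * h)
    have h := ContainsTransvections.of_mem hC (burau_commutatorElement_pow_three hw)
      (by simp [dotProduct, Fin.sum_univ_three])
    have h' := h.smul_left (6 + 12 * w)⁻¹
    rwa [inv_smul_smul₀ hc] at h'
  have hvA : ContainsTransvections H ![1, 1 + w, 0] (Pi.single 2 1) := by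
    have h := (h₀.conj_symm hA (v := ![1, 1 + w, 0]) (f := ![0, 0, -1 - w]) (by
      rw [burau_of_zero]; ext i; fin_cases i <;> simp [mulVec, dotProduct, Fin.sum_univ_three])
      (by rw [burau_of_zero]; ext i; fin_cases i <;> simp [vecMul, dotProduct, Fin.sum_univ_three]
          ; grind)).smul_right w
    convert h using 1
    ext i; fin_cases i <;> simp; grind
  have hvB : ContainsTransvections H ![0, 1, 1 + w] (Pi.single 0 1) := by
    have h := (h₀.conj_symm hB (v := ![0, 1, 1 + w]) (f := ![1 + w, 0, 0]) (by
      rw [burau_of_one]; ext i; fin_cases i <;> simp [mulVec, dotProduct, Fin.sum_univ_three]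
          ; grind)
      (by rw [burau_of_one]; ext i; fin_cases i <;> simp [vecMul, dotProduct, Fin.sum_univ_three]
          ; grind)).smul_right (-w)
    convert h using 1
    ext i; fin_cases i <;> simp; grind
  have h21 : ContainsTransvections H (Pi.single 2 1) (Pi.single 1 1) := by
    convert (h₀.conj_contains hvA (by simp) w).smul_left (-w) using 1
    · ext i; fin_cases i <;> simp <;> grind
    · ext i; fin_cases i <;> simp; grind
  have h20 : ContainsTransvections H (Pi.single 2 1) (Pi.single 0 1) :=
    hvB.commutator h21 (by simp) (by simp) (by simp) (by simp)
  have h10 : ContainsTransvections H (Pi.single 1 1) (Pi.single 0 1) := by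
    convert hvB.add_left (h20.smul_left (-1 - w)) (by simp) using 1
    ext i; fin_cases i <;> simp
  have h02 : ContainsTransvections H (Pi.single 0 1) (Pi.single 2 1) := by
    convert hvA.conj_contains h10 (by simp) (-1 - w) using 1
    · ext i; fin_cases i <;> simp
    · ext i; fin_cases i <;> simp
  have h01 : ContainsTransvections H (Pi.single 0 1) (Pi.single 1 1) :=
    h21.commutator h02 (by simp) (by simp) (by simp) (by simp)
  have h12 : ContainsTransvections H (Pi.single 1 1) (Pi.single 2 1) :=
    h02.commutator h10 (by simp) (by simp) (by simp) (by simp)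
  refine eq_top_of_transvection_mem fun i j hij c ↦ ContainsTransvections.transvection_mem hij ?_ c
  fin_cases i <;> fin_cases j <;> first | exact absurd rfl hij | assumption

theorem projBurau_surjective (h6 : (6 : ZMod p) ≠ 0) : Function.Surjective (projBurau hw) :=
  (QuotientGroup.mk'_surjective _).comp (MonoidHom.range_eq_top.1 (burau_range_eq_top hw h6))

end FreeGroup

theorem Matrix.ProjectiveSpecialLinearGroup.card_le_card (n F : Type*) [Fintype n] [DecidableEq n]
    [Nontrivial n] [Field F] [Finite F] :
    Nat.card F ≤ Nat.card (Matrix.ProjectiveSpecialLinearGroup n F) := by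
  obtain ⟨i, j, hij⟩ := exists_pair_ne n
  refine Nat.card_le_card_of_injective (fun c : F ↦ (QuotientGroup.mk
    (SpecialLinearGroup.transvection hij c) : Matrix.ProjectiveSpecialLinearGroup n F))
    fun c d hcd ↦ ?_
  rw [QuotientGroup.eq, transvection_inv, ← transvection_add, transvection_mem_center_iff] at hcd
  grind

theorem ZMod.exists_sq_add_self_add_one_eq_zero {p : ℕ} [Fact p.Prime] (hp : p ≡ 1 [MOD 3]) :
    ∃ w : ZMod p, w ^ 2 + w + 1 = 0 := by
  have h3 : 3 ∣ Nat.card (ZMod p)ˣ := by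
    rw [Nat.card_eq_fintype_card, ZMod.card_units]
    exact (Nat.modEq_iff_dvd' (Fact.out : p.Prime).one_le).1 hp.symm
  obtain ⟨u, hu⟩ := exists_prime_orderOf_dvd_card' 3 h3
  have h1 : (u : ZMod p) ≠ 1 := fun h ↦ by
    rw [Units.val_eq_one] at h
    simp [h] at hu
  have h2 : (u : ZMod p) ^ 3 = 1 := by
    rw [← Units.val_pow_eq_pow_val, ← hu, pow_orderOf_eq_one, Units.val_one]
  refine ⟨u, mul_left_cancel₀ (sub_ne_zero.2 h1) ?_⟩
  linear_combination h2

end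

/-- The free group on two generators has infinitely many characteristic subgroups `N`
such that the quotient `F₂/N` is a finite simple group.  The condition
"`F₂/N` is a finite simple group" is expressed by saying that `N` is the kernel of a
surjective homomorphism from `F₂` onto some finite simple group `G`. -/
theorem free_group_has_infinitely_many_finite_simple_characteristic_quotients :
    {N : Subgroup (FreeGroup (Fin 2)) |
      N.Characteristic ∧
      ∃ (G : Type) (_ : Group G) (φ : FreeGroup (Fin 2) →* G),
        Finite G ∧ IsSimpleGroup G ∧ Function.Surjective φ ∧ MonoidHom.ker φ = N}.Infinite := by
  intro hfin
  obtain ⟨m, hm⟩ := (hfin.image Subgroup.index).bddAbove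
  obtain ⟨p, hp, hmp, hp3⟩ := Nat.exists_prime_gt_modEq_one (k := 3) m three_ne_zero
  have : Fact p.Prime := ⟨hp⟩
  obtain ⟨w, hw⟩ := ZMod.exists_sq_add_self_add_one_eq_zero hp3
  have h6 : (6 : ZMod p) ≠ 0 := by
    intro h
    have h6 : p ∣ 6 := (ZMod.natCast_eq_zero_iff 6 p).1 (by exact_mod_cast h)
    have := Nat.le_of_dvd (by norm_num) h6
    interval_cases p <;> revert hp3 h6 hp <;> decide
  have hsurj := FreeGroup.projBurau_surjective hw h6
  have hmem := hm ⟨(FreeGroup.projBurau hw).ker, ⟨FreeGroup.characteristic_ker_projBurau hw,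
    _, _, FreeGroup.projBurau hw, inferInstance,
    Matrix.ProjectiveSpecialLinearGroup.isSimpleGroup_three _, hsurj, rfl⟩, rfl⟩
  have hcard := Matrix.ProjectiveSpecialLinearGroup.card_le_card (Fin 3) (ZMod p)
  rw [Subgroup.index_ker, MonoidHom.range_eq_top.2 hsurj, Subgroup.card_top] at hmem
  rw [Nat.card_zmod] at hcard
  omega
end

section
/- Let A be a group, F a normal subgroup of A, G a group, and φ : F → G a surjective group homomorphism. (i) If there exist a group G̃, an injective group homomorphism ι : G → G̃, and a group homomorphism φ̃ : A → G̃ whose restriction to F equals ι ∘ φ, then φ is A-invariant, i.e., for every a ∈ A there exists an automorphism σ of G such that φ(a·f·a⁻¹) = σ(φ(f)) for all f ∈ F. (ii) Conversely, if the center of G is trivial and φ is A-invariant in the above sense, then such a triple (G̃, ι, φ̃) exists; one may take G̃ = Aut(G) and ι : G → Aut(G) the homomorphism sending g to conjugation by g. -/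
universe u v

/-- If the fibres of a surjective homomorphism `φ : H →* G` are preserved by an automorphism `c`
of `H` and by its inverse, then `c` descends to an automorphism of `G`. -/
theorem exists_mulEquiv_of_fibers_preserved {H : Type u} [Group H] {G : Type v} [Group G]
    (φ : H →* G) (hφ : Function.Surjective φ) (c : H ≃* H)
    (hc : ∀ x y, φ x = φ y → φ (c x) = φ (c y))
    (hc' : ∀ x y, φ x = φ y → φ (c.symm x) = φ (c.symm y)) :
    ∃ σ : G ≃* G, ∀ x, φ (c x) = σ (φ x) := by
  have hs := Function.surjInv_eq hφ
  refine ⟨{ toFun := fun g => φ (c (Function.surjInv hφ g))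
            invFun := fun g => φ (c.symm (Function.surjInv hφ g))
            left_inv := fun g => ?_
            right_inv := fun g => ?_
            map_mul' := fun g g' => ?_ }, fun x => hc _ _ (hs _).symm⟩
  · beta_reduce
    rw [hc' _ _ (hs _), c.symm_apply_apply, hs]
  · beta_reduce
    rw [hc _ _ (hs _), c.apply_symm_apply, hs]
  · rw [← map_mul, ← map_mul]
    exact hc _ _ (by rw [hs, map_mul, hs, hs])

theorem mulAut_conj_injective_of_center_eq_bot {G : Type v} [Group G]
    (hG : Subgroup.center G = ⊥) : Function.Injective (MulAut.conj : G →* MulAut G) := by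
  refine (injective_iff_map_eq_one _).2 fun g hg => ?_
  rw [← Subgroup.mem_bot, ← hG, Subgroup.mem_center_iff]
  intro x
  have hx := DFunLike.congr_fun hg x
  rw [MulAut.conj_apply, MulAut.one_apply, mul_inv_eq_iff_eq_mul] at hx
  exact hx.symm

/-- Let `F` be a normal subgroup of `A` and `φ : F → G` a surjective homomorphism.
(i) If `φ` extends, through an embedding `ι : G ↪ G̃`, to a homomorphism `φ̃ : A → G̃`,
then `φ` is `A`-invariant: for every `a ∈ A` there is an automorphism `σ` of `G`
with `φ(a f a⁻¹) = σ (φ f)` for all `f ∈ F`.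
(ii) Conversely, if the center of `G` is trivial and `φ` is `A`-invariant, then such a
triple `(G̃, ι, φ̃)` exists, with `G̃ = Aut(G)` and `ι` the conjugation homomorphism
`G → Aut(G)` (which is injective). -/
theorem invariant_quotient_criterion {A : Type u} [Group A] {G : Type v} [Group G]
    (F : Subgroup A) (hF : F.Normal) (φ : ↥F →* G) (hφ : Function.Surjective φ) :
    (∀ (Gt : Type (max u v)) [Group Gt] (ι : G →* Gt) (φt : A →* Gt),
        Function.Injective ι → (∀ f : ↥F, φt ↑f = ι (φ f)) →
        ∀ a : A, ∃ σ : G ≃* G,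
          ∀ f : ↥F, φ ⟨a * ↑f * a⁻¹, hF.conj_mem ↑f f.2 a⟩ = σ (φ f)) ∧
    (Subgroup.center G = ⊥ →
      (∀ a : A, ∃ σ : G ≃* G,
          ∀ f : ↥F, φ ⟨a * ↑f * a⁻¹, hF.conj_mem ↑f f.2 a⟩ = σ (φ f)) →
      Function.Injective (MulAut.conj : G →* MulAut G) ∧
        ∃ φt : A →* MulAut G, ∀ f : ↥F, φt ↑f = MulAut.conj (φ f)) := by
  refine ⟨fun Gt _ ι φt hι hext a => ?_, fun hG hinv => ?_⟩
  · have key (b : A) (x : F) : ι (φ (MulAut.conjNormal b x)) = φt b * ι (φ x) * (φt b)⁻¹ := by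
      rw [← hext, ← hext, MulAut.conjNormal_apply, map_mul, map_mul, map_inv]
    have fib (b : A) (x y : F) (h : φ x = φ y) :
        φ (MulAut.conjNormal b x) = φ (MulAut.conjNormal b y) :=
      hι (by rw [key, key, h])
    refine exists_mulEquiv_of_fibers_preserved φ hφ (MulAut.conjNormal a) (fib a) fun x y h => ?_
    have h' := fib a⁻¹ x y h
    rwa [map_inv] at h'
  · refine ⟨mulAut_conj_injective_of_center_eq_bot hG, ?_⟩
    choose σ hσ using hinv
    have hσ' (a : A) (f : F) : φ (MulAut.conjNormal a f) = σ a (φ f) := hσ a f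
    refine ⟨MonoidHom.mk' σ fun a b => ?_, fun f => ?_⟩
    · ext g
      obtain ⟨f, rfl⟩ := hφ g
      rw [MulAut.mul_apply, ← hσ', ← hσ', ← hσ', map_mul, MulAut.mul_apply]
    · ext g
      obtain ⟨x, rfl⟩ := hφ g
      rw [MonoidHom.mk'_apply, ← hσ', MulAut.conj_apply, ← map_inv, ← map_mul, ← map_mul]
      exact congrArg φ (Subtype.ext (MulAut.conjNormal_apply _ _))
end

section
/- Let K = ℚ(q) be the field of rational functions in one variable q over ℚ, and let c : K → K be the unique field automorphism fixing ℚ with c(q) = q⁻¹; apply c to matrices entrywise. Let X = X(q), Y = Y(q), let O := [[1, 1, 0], [q+1, 0, 0], [q, 0, 1]] (the matrix with columns v₁ = (1, q+1, q), v₂ = (1,0,0), v₃ = (0,0,1)), and let δ := [[q⁻¹, −q⁻², 0], [0, −q⁻², 0], [0, −q⁻², q⁻³]]. Then O and δ are invertible over K, and the following matrix identities hold in GL₃(K): δ⁻¹·O·c(O⁻¹·X·O)·O⁻¹·δ = X⁻¹ and δ⁻¹·O·c(O⁻¹·Y·O)·O⁻¹·δ = Y. -/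
open Matrix

noncomputable section

/-- The variable `q`, i.e. `X`, in the rational function field `ℚ(q)`. -/
def qvar : RatFunc ℚ := RatFunc.X

/-- The Burau matrix `X(q)` (image of `x = σ₁σ₃⁻¹`). -/
def Xburau : Matrix (Fin 3) (Fin 3) (RatFunc ℚ) :=
  !![-qvar, 1, 0; 0, 1, 0; 0, 1, -qvar⁻¹]

/-- The Burau matrix `Y(q)` (image of `y = σ₂σ₁σ₃⁻¹σ₂⁻¹`). -/
def Yburau : Matrix (Fin 3) (Fin 3) (RatFunc ℚ) :=
  !![1 - qvar, -qvar⁻¹, qvar⁻¹; 1 - qvar ^ 2, -qvar⁻¹, 0; 1, -qvar⁻¹, 0]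

/-- The matrix `O` whose columns are `v₁ = (1, q+1, q)`, `v₂ = e₁`, `v₃ = e₃`. -/
def Omat : Matrix (Fin 3) (Fin 3) (RatFunc ℚ) :=
  !![1, 1, 0; qvar + 1, 0, 0; qvar, 0, 1]

/-- The matrix `δ`. -/
def deltaMat : Matrix (Fin 3) (Fin 3) (RatFunc ℚ) :=
  !![qvar⁻¹, -(qvar ^ 2)⁻¹, 0; 0, -(qvar ^ 2)⁻¹, 0; 0, -(qvar ^ 2)⁻¹, (qvar ^ 3)⁻¹]

lemma qvar_ne_zero : qvar ≠ 0 := RatFunc.X_ne_zero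

lemma qvar_add_one_ne_zero : qvar + 1 ≠ 0 := by
  have h : qvar + 1 = algebraMap (Polynomial ℚ) (RatFunc ℚ) (Polynomial.X + Polynomial.C 1) := by
    simp [qvar]
  rw [h]
  exact RatFunc.algebraMap_ne_zero (Polynomial.X_add_C_ne_zero 1)

lemma isUnit_det_Omat : IsUnit Omat.det := by
  rw [isUnit_iff_ne_zero]
  have h : Omat.det = -(qvar + 1) := by simp [Omat, Matrix.det_fin_three]
  rw [h]
  exact neg_ne_zero.mpr qvar_add_one_ne_zero

lemma isUnit_det_deltaMat : IsUnit deltaMat.det := by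
  simp [deltaMat, Matrix.det_fin_three, qvar_ne_zero]

lemma Xburau_inv : Xburau⁻¹ = !![-qvar⁻¹, qvar⁻¹, 0; 0, 1, 0; 0, qvar, -qvar] := by
  have h := qvar_ne_zero
  refine Matrix.inv_eq_right_inv ?_
  ext i j
  fin_cases i <;> fin_cases j <;> simp [Xburau, Matrix.mul_apply, Fin.sum_univ_three, h]

/-- The matrix `c(O) * O⁻¹ * δ`, where `c` inverts `q`. -/
def twistMat : Matrix (Fin 3) (Fin 3) (RatFunc ℚ) :=
  !![qvar⁻¹, -(qvar ^ 2)⁻¹, 0; 0, -(qvar ^ 3)⁻¹, 0; 0, -(qvar ^ 3)⁻¹, (qvar ^ 3)⁻¹]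

lemma map_Omat_mul_inv_mul_deltaMat (c : RatFunc ℚ ≃+* RatFunc ℚ) (hc : c qvar = qvar⁻¹) :
    Omat.map ⇑c * Omat⁻¹ * deltaMat = twistMat := by
  have h := qvar_ne_zero
  have hO : Omat.map ⇑c = !![1, 0, 0; 0, qvar⁻¹, 0; 0, qvar⁻¹ - 1, 1] * Omat := by
    ext i j
    fin_cases i <;> fin_cases j <;>
      simp [Omat, Matrix.mul_apply, Fin.sum_univ_three, hc] <;> field_simp <;> ring
  rw [hO, Matrix.mul_nonsing_inv_cancel_right _ _ isUnit_det_Omat]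
  ext i j
  fin_cases i <;> fin_cases j <;>
    simp [deltaMat, twistMat, Matrix.mul_apply, Fin.sum_univ_three] <;> field_simp <;> ring

lemma conj_map_eq_of_map_mul_twistMat (c : RatFunc ℚ ≃+* RatFunc ℚ) (hc : c qvar = qvar⁻¹)
    {M N : Matrix (Fin 3) (Fin 3) (RatFunc ℚ)} (h : M.map ⇑c * twistMat = twistMat * N) :
    deltaMat⁻¹ * Omat * ((Omat⁻¹ * M * Omat).map ⇑c) * Omat⁻¹ * deltaMat = N := by
  have hT := map_Omat_mul_inv_mul_deltaMat c hc
  have hinv : deltaMat⁻¹ * Omat * Omat⁻¹.map ⇑c * twistMat = 1 := by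
    have hO : Omat⁻¹.map ⇑c * Omat.map ⇑c = 1 := by
      rw [← Matrix.map_mul, Matrix.nonsing_inv_mul _ isUnit_det_Omat]
      simp
    calc deltaMat⁻¹ * Omat * Omat⁻¹.map ⇑c * twistMat
        = deltaMat⁻¹ * Omat * (Omat⁻¹.map ⇑c * Omat.map ⇑c) * Omat⁻¹ * deltaMat := by
          rw [← hT]; simp only [Matrix.mul_assoc]
      _ = 1 := by
          rw [hO, Matrix.mul_one, Matrix.mul_nonsing_inv_cancel_right _ _ isUnit_det_Omat,
            Matrix.nonsing_inv_mul _ isUnit_det_deltaMat]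
  calc deltaMat⁻¹ * Omat * ((Omat⁻¹ * M * Omat).map ⇑c) * Omat⁻¹ * deltaMat
      = deltaMat⁻¹ * Omat * Omat⁻¹.map ⇑c *
          (M.map ⇑c * (Omat.map ⇑c * Omat⁻¹ * deltaMat)) := by
        simp only [Matrix.map_mul, Matrix.mul_assoc]
    _ = N := by rw [hT, h, ← Matrix.mul_assoc, hinv, Matrix.one_mul]

/-- Let `c` be the (unique) field automorphism of `K = ℚ(q)` with `c q = q⁻¹` (any such
automorphism automatically fixes `ℚ`).  Then `O` and `δ` are invertible over `K`, and
conjugating the entrywise `c`-twist of the Burau matrices `X`, `Y` by `O⁻¹ δ` sends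
`X ↦ X⁻¹` and `Y ↦ Y`. -/
theorem burau_bootstrap (c : RatFunc ℚ ≃+* RatFunc ℚ) (hc : c qvar = qvar⁻¹) :
    IsUnit Omat.det ∧ IsUnit deltaMat.det ∧
    deltaMat⁻¹ * Omat * ((Omat⁻¹ * Xburau * Omat).map ⇑c) * Omat⁻¹ * deltaMat = Xburau⁻¹ ∧
    deltaMat⁻¹ * Omat * ((Omat⁻¹ * Yburau * Omat).map ⇑c) * Omat⁻¹ * deltaMat = Yburau := by
  have h := qvar_ne_zero
  refine ⟨isUnit_det_Omat, isUnit_det_deltaMat, conj_map_eq_of_map_mul_twistMat c hc ?_,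
    conj_map_eq_of_map_mul_twistMat c hc ?_⟩
  · rw [Xburau_inv]
    ext i j
    fin_cases i <;> fin_cases j <;>
      simp [Xburau, twistMat, Matrix.mul_apply, Fin.sum_univ_three, hc] <;> field_simp <;> ring
  · ext i j
    fin_cases i <;> fin_cases j <;>
      simp [Yburau, twistMat, Matrix.mul_apply, Fin.sum_univ_three, hc] <;> field_simp <;> ring

end
end

section
/- Let K = ℚ(q) be the field of rational functions in one variable q over ℚ. For g ∈ GL₃(K), let AdTr(g) denote the trace of the K-linear endomorphism A ↦ g·A·g⁻¹ of the space of trace-zero matrices in M₃(K). Then AdTr(X(q)) = q² − 2q + 2 − 2q⁻¹ + q⁻², AdTr(X(q)²) = q⁴ + 2q² + 2 + 2q⁻² + q⁻⁴, and AdTr(X(q))² − AdTr(X(q)²) − 6·AdTr(X(q)) = −4q³ − 4q⁻³. Consequently, the subfield of K generated over ℚ by {AdTr(g) : g in the subgroup of GL₃(K) generated by X(q) and Y(q)} contains q³ + q⁻³. -/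
open Matrix

noncomputable section

/-- The Burau matrix `X(q)`. -/
def Xmat {K : Type*} [Field K] (q : K) : Matrix (Fin 3) (Fin 3) K :=
  !![-q, 1, 0; 0, 1, 0; 0, 1, -q⁻¹]

/-- The Burau matrix `Y(q)`. -/
def Ymat {K : Type*} [Field K] (q : K) : Matrix (Fin 3) (Fin 3) K :=
  !![1 - q, -q⁻¹, q⁻¹; 1 - q ^ 2, -q⁻¹, 0; 1, -q⁻¹, 0]

/-- The space of trace-zero `3×3` matrices over `K = ℚ(q)`. -/
def sl3 : Submodule (RatFunc ℚ) (Matrix (Fin 3) (Fin 3) (RatFunc ℚ)) :=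
  LinearMap.ker (Matrix.traceLinearMap (Fin 3) (RatFunc ℚ) (RatFunc ℚ))

/-- The adjoint (conjugation) action of `g ∈ GL₃(ℚ(q))` on trace-zero matrices,
`A ↦ g A g⁻¹`. -/
def adEnd (g : (Matrix (Fin 3) (Fin 3) (RatFunc ℚ))ˣ) : ↥sl3 →ₗ[RatFunc ℚ] ↥sl3 where
  toFun A := ⟨(g : Matrix (Fin 3) (Fin 3) (RatFunc ℚ)) * (A : Matrix (Fin 3) (Fin 3) (RatFunc ℚ)) *
      ((g⁻¹ : (Matrix (Fin 3) (Fin 3) (RatFunc ℚ))ˣ) : Matrix (Fin 3) (Fin 3) (RatFunc ℚ)), by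
    have hA : ((A : Matrix (Fin 3) (Fin 3) (RatFunc ℚ))).trace = 0 := A.2
    have : ((g : Matrix (Fin 3) (Fin 3) (RatFunc ℚ)) * (A : Matrix (Fin 3) (Fin 3) (RatFunc ℚ)) *
        ((g⁻¹ : (Matrix (Fin 3) (Fin 3) (RatFunc ℚ))ˣ) : Matrix (Fin 3) (Fin 3) (RatFunc ℚ))).trace
        = ((A : Matrix (Fin 3) (Fin 3) (RatFunc ℚ))).trace := by
      rw [Matrix.trace_mul_comm, ← mul_assoc, g.inv_mul, one_mul]
    simpa [sl3, LinearMap.mem_ker] using this.trans hA⟩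
  map_add' A B := by
    ext1
    simp [mul_add, add_mul]
  map_smul' c A := by
    ext1
    simp [Matrix.mul_smul, Matrix.smul_mul]

/-- `AdTr g` is the trace of the conjugation action of `g` on trace-zero matrices. -/
def AdTr (g : (Matrix (Fin 3) (Fin 3) (RatFunc ℚ))ˣ) : RatFunc ℚ :=
  LinearMap.trace (RatFunc ℚ) ↥sl3 (adEnd g)

/-- The trace of a two-sided multiplication `A ↦ M * A * N` is the product of the traces. -/
theorem trace_mulLeft_comp_mulRight {n K : Type*} [Fintype n] [DecidableEq n] [Field K]
    (M N : Matrix n n K) :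
    LinearMap.trace K (Matrix n n K) (LinearMap.mulLeft K M ∘ₗ LinearMap.mulRight K N) =
      M.trace * N.trace := by
  rw [LinearMap.trace_eq_matrix_trace K (Matrix.stdBasis K n n), Matrix.trace,
    Fintype.sum_prod_type, Matrix.trace, Matrix.trace, Finset.sum_mul_sum]
  refine Finset.sum_congr rfl fun i _ => Finset.sum_congr rfl fun j _ => ?_
  have hcoord (A : Matrix n n K) : (Matrix.stdBasis K n n).repr A (i, j) = A i j := by
    simp [Matrix.stdBasis]
  simp [LinearMap.toMatrix_apply, hcoord, Matrix.stdBasis_eq_single, Matrix.mul_apply,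
    Matrix.single_apply, ite_and]

/-- The projection of a `3×3` matrix onto its trace-zero part. -/
def sl3Proj : Matrix (Fin 3) (Fin 3) (RatFunc ℚ) →ₗ[RatFunc ℚ] ↥sl3 :=
  (LinearMap.id - ((3 : RatFunc ℚ)⁻¹ •
    Matrix.traceLinearMap (Fin 3) (RatFunc ℚ) (RatFunc ℚ)).smulRight 1).codRestrict sl3 fun A => by
      simp [sl3, LinearMap.mem_ker, Matrix.trace_one]
      ring

theorem sl3Proj_comp_subtype : sl3Proj ∘ₗ sl3.subtype = LinearMap.id := by
  ext1 A
  have hA : (A : Matrix (Fin 3) (Fin 3) (RatFunc ℚ)).trace = 0 := A.2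
  ext1
  simp [sl3Proj, hA]

theorem AdTr_eq_trace_mul_trace_inv (g : (Matrix (Fin 3) (Fin 3) (RatFunc ℚ))ˣ) :
    AdTr g = (g : Matrix (Fin 3) (Fin 3) (RatFunc ℚ)).trace *
      ((g⁻¹ : (Matrix (Fin 3) (Fin 3) (RatFunc ℚ))ˣ) :
        Matrix (Fin 3) (Fin 3) (RatFunc ℚ)).trace - 1 := by
  have hcomp : sl3.subtype ∘ₗ adEnd g ∘ₗ sl3Proj =
      LinearMap.mulLeft (RatFunc ℚ) (g : Matrix (Fin 3) (Fin 3) (RatFunc ℚ)) ∘ₗ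
        LinearMap.mulRight (RatFunc ℚ) ((g⁻¹ : (Matrix (Fin 3) (Fin 3) (RatFunc ℚ))ˣ) :
          Matrix (Fin 3) (Fin 3) (RatFunc ℚ)) -
      ((3 : RatFunc ℚ)⁻¹ •
        Matrix.traceLinearMap (Fin 3) (RatFunc ℚ) (RatFunc ℚ)).smulRight 1 := by
    refine LinearMap.ext fun A => ?_
    simp [adEnd, sl3Proj, mul_sub, sub_mul, mul_assoc, -Matrix.coe_units_inv]
  calc AdTr g = LinearMap.trace (RatFunc ℚ) ↥sl3 ((adEnd g ∘ₗ sl3Proj) ∘ₗ sl3.subtype) := by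
        rw [LinearMap.comp_assoc, sl3Proj_comp_subtype, LinearMap.comp_id, AdTr]
    _ = _ := by
        rw [LinearMap.trace_comp_comm', hcomp, map_sub, trace_mulLeft_comp_mulRight,
          LinearMap.trace_smulRight]
        simp [Matrix.trace_one]

theorem coe_inv_of_coe_eq_Xmat {K : Type*} [Field K] {q : K} (hq : q ≠ 0)
    {u : (Matrix (Fin 3) (Fin 3) K)ˣ} (hu : (u : Matrix (Fin 3) (Fin 3) K) = Xmat q) :
    ((u⁻¹ : (Matrix (Fin 3) (Fin 3) K)ˣ) : Matrix (Fin 3) (Fin 3) K) =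
      !![-q⁻¹, q⁻¹, 0; 0, 1, 0; 0, q, -q] := by
  refine Units.inv_eq_of_mul_eq_one_right ?_
  rw [hu, Xmat, Matrix.mul_fin_three, Matrix.one_fin_three]
  simp [hq]

/-- Trace computations for the adjoint representation at the Burau matrix `X(q)`,
and the consequence that the field generated over `ℚ` by the adjoint traces of the
group generated by `X(q)` and `Y(q)` contains `q³ + q⁻³`. -/
theorem adjoint_trace_field_contains (xu yu : (Matrix (Fin 3) (Fin 3) (RatFunc ℚ))ˣ)
    (hx : (xu : Matrix (Fin 3) (Fin 3) (RatFunc ℚ)) = Xmat (RatFunc.X : RatFunc ℚ))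
    (hy : (yu : Matrix (Fin 3) (Fin 3) (RatFunc ℚ)) = Ymat (RatFunc.X : RatFunc ℚ)) :
    AdTr xu = RatFunc.X ^ 2 - 2 * RatFunc.X + 2 - 2 * RatFunc.X⁻¹ + RatFunc.X⁻¹ ^ 2 ∧
    AdTr (xu ^ 2) = RatFunc.X ^ 4 + 2 * RatFunc.X ^ 2 + 2 + 2 * RatFunc.X⁻¹ ^ 2
      + RatFunc.X⁻¹ ^ 4 ∧
    (AdTr xu) ^ 2 - AdTr (xu ^ 2) - 6 * AdTr xu = -4 * RatFunc.X ^ 3 - 4 * RatFunc.X⁻¹ ^ 3 ∧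
    (RatFunc.X ^ 3 + RatFunc.X⁻¹ ^ 3 : RatFunc ℚ) ∈
      Subfield.closure {a : RatFunc ℚ | ∃ g ∈ Subgroup.closure {xu, yu}, AdTr g = a} := by
  have hq : (RatFunc.X : RatFunc ℚ) ≠ 0 := RatFunc.X_ne_zero
  have hinv := coe_inv_of_coe_eq_Xmat hq hx
  have h1 : AdTr xu = RatFunc.X ^ 2 - 2 * RatFunc.X + 2 - 2 * RatFunc.X⁻¹
      + RatFunc.X⁻¹ ^ 2 := by
    rw [AdTr_eq_trace_mul_trace_inv, hinv, hx, Xmat, Matrix.trace_fin_three_of,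
      Matrix.trace_fin_three_of]
    field_simp
    ring
  have h2 : AdTr (xu ^ 2) = RatFunc.X ^ 4 + 2 * RatFunc.X ^ 2 + 2 + 2 * RatFunc.X⁻¹ ^ 2
      + RatFunc.X⁻¹ ^ 4 := by
    rw [AdTr_eq_trace_mul_trace_inv, ← inv_pow, Units.val_pow_eq_pow_val,
      Units.val_pow_eq_pow_val, hinv, hx, Xmat, sq, sq, Matrix.mul_fin_three,
      Matrix.mul_fin_three, Matrix.trace_fin_three_of, Matrix.trace_fin_three_of]
    field_simp
    ring
  have h3 : (AdTr xu) ^ 2 - AdTr (xu ^ 2) - 6 * AdTr xu =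
      -4 * RatFunc.X ^ 3 - 4 * RatFunc.X⁻¹ ^ 3 := by
    rw [h1, h2]
    field_simp
    ring
  refine ⟨h1, h2, h3, ?_⟩
  set F := Subfield.closure {a : RatFunc ℚ | ∃ g ∈ Subgroup.closure {xu, yu}, AdTr g = a}
  have hxu : xu ∈ Subgroup.closure {xu, yu} := Subgroup.subset_closure (by simp)
  have m1 : AdTr xu ∈ F := Subfield.subset_closure ⟨xu, hxu, rfl⟩
  have m2 : AdTr (xu ^ 2) ∈ F := Subfield.subset_closure ⟨xu ^ 2, pow_mem hxu 2, rfl⟩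
  have key : (RatFunc.X ^ 3 + RatFunc.X⁻¹ ^ 3 : RatFunc ℚ) =
      ((AdTr xu) ^ 2 - AdTr (xu ^ 2) - 6 * AdTr xu) / (-4) := by
    rw [h3]
    ring
  rw [key]
  exact div_mem (sub_mem (sub_mem (pow_mem m1 2) m2) (mul_mem (ofNat_mem F 6) m1))
    (neg_mem (ofNat_mem F 4))

end
end

section
/- Let k₀ be a finite field with |k₀| = Q, where Q ∉ {2, 3, 4, 5, 7} (equivalently Q ≥ 8). Then there exists a unit t ∈ k₀ with t⁴ ≠ 1 such that X(t) and Y(t) belong to SL₃(k₀) and the subgroup of SL₃(k₀) generated by X(t) and Y(t) is all of SL₃(k₀). -/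
open Matrix

section Generation

variable {F : Type*} [Field F]

theorem det_Xmat {q : F} (hq : q ≠ 0) : (Xmat q).det = 1 := by
  simp [Xmat, det_fin_three, hq]

theorem det_Ymat {q : F} (hq : q ≠ 0) : (Ymat q).det = 1 := by
  simp [Ymat, det_fin_three]
  field_simp
  ring

theorem transvection_mul_apply {n : Type*} [DecidableEq n] [Fintype n] (i j : n) (c : F)
    (M : Matrix n n F) (k l : n) :
    (transvection i j c * M) k l = M k l + if k = i then c * M j l else 0 := by
  split_ifs with h
  · rw [h, transvection_mul_apply_same]
  · rw [transvection_mul_apply_of_ne _ _ _ _ h, add_zero]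

/-- The special linear group is generated by elementary matrices. -/
theorem mem_of_forall_transvection_mem {n : Type*} [DecidableEq n] [Fintype n] [Nontrivial n]
    (S : Submonoid (Matrix n n F))
    (h : ∀ i j : n, i ≠ j → ∀ c : F, transvection i j c ∈ S)
    (M : SpecialLinearGroup n F) : (M : Matrix n n F) ∈ S := by
  refine Matrix.SpecialLinearGroup.diagonal_transvection_induction'
    (fun A => (A : Matrix n n F) ∈ S) M ?_ (fun i j hij a => h i j hij a) fun A B hA hB => ?_
  · intro i j hij c hc
    have key : (Matrix.SpecialLinearGroup.diag2n hij c hc : Matrix n n F) =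
        transvection i j c * (transvection j i (-c⁻¹) * (transvection i j c *
          (transvection i j (-1) * (transvection j i 1 * (transvection i j (-1) * 1))))) := by
      rw [Matrix.SpecialLinearGroup.diag2n_coe]
      ext k l
      simp only [transvection_mul_apply, Matrix.one_apply, Matrix.diagonal_apply]
      grind
    change _ ∈ S
    rw [key]
    have h1 := h i j hij
    have h2 := h j i hij.symm
    exact S.mul_mem (h1 _) (S.mul_mem (h2 _) (S.mul_mem (h1 _) (S.mul_mem (h1 _)
      (S.mul_mem (h2 _) (S.mul_mem (h1 _) S.one_mem)))))
  · simpa using S.mul_mem hA hB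

section

variable (S : Submonoid (Matrix (Fin 3) (Fin 3) F))
  (hinv : ∀ M N : Matrix (Fin 3) (Fin 3) F, M * N = 1 → M ∈ S → N ∈ S)
  (hT : ∀ s : F, s ≠ 0 → !![s, 0, 0; 0, 1, 0; 0, 0, s⁻¹] ∈ S)

include hinv hT

theorem upper_transvection_mem {a p w z e : F} (ha0 : a ≠ 0) (ha1 : a - 1 ≠ 0) (hp : p ≠ 0)
    (hw : w ≠ 0) (hz : z ≠ 0) (he : e ≠ 0) (h : !![p, z, 0; 0, w, 0; 0, 0, e] ∈ S) (c : F) :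
    !![1, c, 0; 0, 1, 0; 0, 0, 1] ∈ S := by
  have h' : !![p⁻¹, -z / (p * w), 0; 0, w⁻¹, 0; 0, 0, e⁻¹] ∈ S := by
    refine hinv _ _ ?_ h
    ext i j
    fin_cases i <;> fin_cases j <;> simp [Matrix.mul_apply, Fin.sum_univ_three, hp, hw, he]
    field_simp
    ring
  have h0 : !![1, (a - 1) * z / w, 0; 0, 1, 0; 0, 0, 1] ∈ S := by
    convert S.mul_mem (S.mul_mem (S.mul_mem (hT a ha0) h) (hT a⁻¹ (inv_ne_zero ha0))) h' using 1
    ext i j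
    fin_cases i <;> fin_cases j <;> simp [Matrix.mul_apply, Fin.sum_univ_three]
    all_goals field_simp
    ring
  rcases eq_or_ne c 0 with rfl | hc
  · convert S.one_mem using 1
    ext i j
    fin_cases i <;> fin_cases j <;> simp
  · obtain ⟨s, hs⟩ : ∃ s : F, s = c / ((a - 1) * z / w) := ⟨_, rfl⟩
    have hs0 : s ≠ 0 := by
      rw [hs]
      exact div_ne_zero hc (div_ne_zero (mul_ne_zero ha1 hz) hw)
    convert S.mul_mem (S.mul_mem (hT s hs0) h0) (hT s⁻¹ (inv_ne_zero hs0)) using 1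
    ext i j
    fin_cases i <;> fin_cases j <;> simp [Matrix.mul_apply, Fin.sum_univ_three, hs0]
    rw [hs]
    field_simp

theorem lower_transvection_mem {a p w z e : F} (ha0 : a ≠ 0) (ha1 : a - 1 ≠ 0) (hp : p ≠ 0)
    (hw : w ≠ 0) (hz : z ≠ 0) (he : e ≠ 0) (h : !![p, 0, 0; z, w, 0; 0, 0, e] ∈ S) (c : F) :
    !![1, 0, 0; c, 1, 0; 0, 0, 1] ∈ S := by
  have h' : !![p⁻¹, 0, 0; -z / (p * w), w⁻¹, 0; 0, 0, e⁻¹] ∈ S := by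
    refine hinv _ _ ?_ h
    ext i j
    fin_cases i <;> fin_cases j <;> simp [Matrix.mul_apply, Fin.sum_univ_three, hp, hw, he]
    field_simp
    ring
  have h0 : !![1, 0, 0; (a - 1) * z / p, 1, 0; 0, 0, 1] ∈ S := by
    convert S.mul_mem (S.mul_mem (S.mul_mem (hT a⁻¹ (inv_ne_zero ha0)) h) (hT a ha0)) h' using 1
    ext i j
    fin_cases i <;> fin_cases j <;> simp [Matrix.mul_apply, Fin.sum_univ_three]
    all_goals field_simp
    ring
  rcases eq_or_ne c 0 with rfl | hc
  · convert S.one_mem using 1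
    ext i j
    fin_cases i <;> fin_cases j <;> simp
  · obtain ⟨s, hs⟩ : ∃ s : F, s = c / ((a - 1) * z / p) := ⟨_, rfl⟩
    have hs0 : s ≠ 0 := by
      rw [hs]
      exact div_ne_zero hc (div_ne_zero (mul_ne_zero ha1 hz) hp)
    convert S.mul_mem (S.mul_mem (hT s⁻¹ (inv_ne_zero hs0)) h0) (hT s hs0) using 1
    ext i j
    fin_cases i <;> fin_cases j <;> simp [Matrix.mul_apply, Fin.sum_univ_three, hs0]
    rw [hs]
    field_simp

/-- Two one-parameter groups of block homologies in general position generate the elementary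
matrices of the block. -/
theorem block_transvection_mem {u v x y : F} (huv : u + v = 1) (hxy : x * y = u * v)
    (hx : x ≠ 0) (hy : y ≠ 0)
    (hT' : ∀ s : F, s ≠ 0 → !![1 + (s - 1) * v, (s - 1) * x, 0;
      (s - 1) * y, 1 + (s - 1) * u, 0; 0, 0, s⁻¹] ∈ S)
    {a b : F} (ha0 : a ≠ 0) (ha1 : a - 1 ≠ 0) (hb0 : b ≠ 0) (hb1 : b - 1 ≠ 0)
    (hab : b - a ≠ 0) (hab' : a * b - 1 ≠ 0)
    (hav : 1 + (a - 1) * v ≠ 0) (hbu : 1 + (b - 1) * u ≠ 0) (c : F) :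
    !![1, c, 0; 0, 1, 0; 0, 0, 1] ∈ S ∧ !![1, 0, 0; c, 1, 0; 0, 0, 1] ∈ S := by
  obtain rfl : v = 1 - u := by linear_combination huv
  obtain ⟨r, hr⟩ : ∃ r : F, r = -((a - 1) * (1 + (b - 1) * u)) /
    ((b - 1) * (1 + (a - 1) * (1 - u))) := ⟨_, rfl⟩
  have hr0 : r ≠ 0 := by
    rw [hr]
    exact div_ne_zero (neg_ne_zero.2 (mul_ne_zero ha1 hbu)) (mul_ne_zero hb1 hav)
  have hr' : r * ((b - 1) * (1 + (a - 1) * (1 - u))) = -((a - 1) * (1 + (b - 1) * u)) := by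
    rw [hr]
    field_simp
  have he : (a * b * r)⁻¹ ≠ 0 := inv_ne_zero (mul_ne_zero (mul_ne_zero ha0 hb0) hr0)
  constructor
  · obtain ⟨z, hz⟩ : ∃ z : F,
        z = r * (1 + (b - 1) * (1 - u)) * (a - 1) + (b - 1) * (1 + (a - 1) * u) := ⟨_, rfl⟩
    obtain ⟨p, hp⟩ : ∃ p : F, p = r * (1 + (b - 1) * (1 - u)) * (1 + (a - 1) * (1 - u)) +
        (b - 1) * (a - 1) * (x * y) := ⟨_, rfl⟩
    obtain ⟨w, hw⟩ : ∃ w : F, w = r * (b - 1) * (a - 1) * (x * y) +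
        (1 + (b - 1) * u) * (1 + (a - 1) * u) := ⟨_, rfl⟩
    have hz0 : z ≠ 0 := by
      have : z * ((b - 1) * (1 + (a - 1) * (1 - u))) = (b - a) * (a * b - 1) := by
        rw [hz]
        linear_combination (1 + (b - 1) * (1 - u)) * (a - 1) * hr'
      exact left_ne_zero_of_mul (this ▸ mul_ne_zero hab hab')
    have hpw : p * w = a * b * r := by
      rw [hp, hw, hxy]
      linear_combination (r * (1 + (b - 1) * (1 - u)) * (a - 1) + (b - 1) * (1 + (a - 1) * u)) *
        (u * (1 - u)) * hr'
    have hpw0 : p * w ≠ 0 := hpw ▸ mul_ne_zero (mul_ne_zero ha0 hb0) hr0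
    refine upper_transvection_mem S hinv hT ha0 ha1 (left_ne_zero_of_mul hpw0)
      (right_ne_zero_of_mul hpw0) (mul_ne_zero hz0 hx) he ?_ c
    convert S.mul_mem (S.mul_mem (hT' b hb0) (hT r hr0)) (hT' a ha0) using 1
    ext i j
    fin_cases i <;> fin_cases j <;> simp [Matrix.mul_apply, Fin.sum_univ_three]
    · rw [hp]; ring
    · rw [hz]; ring
    · linear_combination (-y) * hr'
    · rw [hw]; ring
    · ring
  · obtain ⟨z, hz⟩ : ∃ z : F,
        z = r * (1 + (b - 1) * (1 - u)) * (a - 1) + (b - 1) * (1 + (a - 1) * u) := ⟨_, rfl⟩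
    obtain ⟨p, hp⟩ : ∃ p : F, p = r * (1 + (b - 1) * (1 - u)) * (1 + (a - 1) * (1 - u)) +
        (b - 1) * (a - 1) * (x * y) := ⟨_, rfl⟩
    obtain ⟨w, hw⟩ : ∃ w : F, w = r * (b - 1) * (a - 1) * (x * y) +
        (1 + (a - 1) * u) * (1 + (b - 1) * u) := ⟨_, rfl⟩
    have hz0 : z ≠ 0 := by
      have : z * ((b - 1) * (1 + (a - 1) * (1 - u))) = (b - a) * (a * b - 1) := by
        rw [hz]
        linear_combination (1 + (b - 1) * (1 - u)) * (a - 1) * hr'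
      exact left_ne_zero_of_mul (this ▸ mul_ne_zero hab hab')
    have hpw : p * w = a * b * r := by
      rw [hp, hw, hxy]
      linear_combination (r * (1 + (b - 1) * (1 - u)) * (a - 1) + (b - 1) * (1 + (a - 1) * u)) *
        (u * (1 - u)) * hr'
    have hpw0 : p * w ≠ 0 := hpw ▸ mul_ne_zero (mul_ne_zero ha0 hb0) hr0
    refine lower_transvection_mem S hinv hT ha0 ha1 (left_ne_zero_of_mul hpw0)
      (right_ne_zero_of_mul hpw0) (mul_ne_zero hz0 hy) he ?_ c
    convert S.mul_mem (S.mul_mem (hT' a ha0) (hT r hr0)) (hT' b hb0) using 1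
    ext i j
    fin_cases i <;> fin_cases j <;> simp [Matrix.mul_apply, Fin.sum_univ_three]
    · rw [hp]; ring
    · linear_combination (-x) * hr'
    · rw [hz]; ring
    · rw [hw]; ring
    · ring

/-- A group containing the torus `diag(s, 1, s⁻¹)` and a matrix that maps the third coordinate axis
into the plane of the first two, and the first axis onto the third one, contains every elementary
matrix. -/
theorem forall_transvection_mem {a b c d q : F} (ha : a ≠ 0) (hb : b ≠ 0) (hc : c ≠ 0) (hd : d ≠ 0)
    (hdet : q * (a * d - b * c) = 1) (hX : !![0, a, b; 0, c, d; q, 0, 0] ∈ S)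
    {s t : F} (hs0 : s ≠ 0) (hs1 : s - 1 ≠ 0) (ht0 : t ≠ 0) (ht1 : t - 1 ≠ 0)
    (hst : t - s ≠ 0) (hst' : s * t - 1 ≠ 0)
    (hsv : 1 + (s - 1) * -(q * b * c) ≠ 0) (htu : 1 + (t - 1) * (q * a * d) ≠ 0)
    (i j : Fin 3) (hij : i ≠ j) (e : F) : transvection i j e ∈ S := by
  have hq : q ≠ 0 := left_ne_zero_of_mul (hdet ▸ one_ne_zero)
  have hX' : !![0, 0, q⁻¹; q * d, -(q * b), 0; -(q * c), q * a, 0] ∈ S := by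
    refine hinv _ _ ?_ hX
    ext i j
    fin_cases i <;> fin_cases j <;> simp [Matrix.mul_apply, Fin.sum_univ_three, hq]
    · linear_combination hdet
    · ring
    · ring
    · linear_combination hdet
  have hblock := block_transvection_mem S hinv hT (u := q * a * d) (v := -(q * b * c))
    (x := q * a * b) (y := -(q * c * d)) (by linear_combination hdet) (by ring)
    (mul_ne_zero (mul_ne_zero hq ha) hb) (neg_ne_zero.2 (mul_ne_zero (mul_ne_zero hq hc) hd))
    (fun r hr => by
      convert S.mul_mem (S.mul_mem hX (hT r⁻¹ (inv_ne_zero hr))) hX' using 1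
      ext i j
      fin_cases i <;> fin_cases j <;> simp [Matrix.mul_apply, Fin.sum_univ_three]
      · linear_combination -hdet
      · ring
      · ring
      · linear_combination -hdet
      · field_simp) hs0 hs1 ht0 ht1 hst hst' hsv htu
  have hrow : ∀ r e : F, r ≠ 0 → !![1, 0, 0; 0, 1, 0; e * d * r, -(e * b), 1] ∈ S := by
    have hrow0 : ∀ e : F, !![1, 0, 0; 0, 1, 0; e * d, -(e * b), 1] ∈ S := by
      intro e
      convert S.mul_mem (S.mul_mem hX (hblock (e / q ^ 2)).1) hX' using 1
      ext i j
      fin_cases i <;> fin_cases j <;> simp [Matrix.mul_apply, Fin.sum_univ_three, hq]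
      · linear_combination -hdet
      · ring
      · ring
      · linear_combination -hdet
      · field_simp
      · field_simp
    intro r e hr
    convert S.mul_mem (S.mul_mem (hT r⁻¹ (inv_ne_zero hr)) (hrow0 (e / r))) (hT r hr) using 1
    ext i j
    fin_cases i <;> fin_cases j <;> simp [Matrix.mul_apply, Fin.sum_univ_three, hr]
    all_goals field_simp
  have hcol : ∀ r e : F, r ≠ 0 → !![1, 0, e * a * r; 0, 1, e * c; 0, 0, 1] ∈ S := by
    have hcol0 : ∀ e : F, !![1, 0, e * a; 0, 1, e * c; 0, 0, 1] ∈ S := by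
      intro e
      convert S.mul_mem (S.mul_mem hX (hblock (e * q)).2) hX' using 1
      ext i j
      fin_cases i <;> fin_cases j <;> simp [Matrix.mul_apply, Fin.sum_univ_three, hq]
      · linear_combination -hdet
      · ring
      · field_simp
      · ring
      · linear_combination -hdet
      · field_simp
    intro r e hr
    convert S.mul_mem (S.mul_mem (hT r hr) (hcol0 (e / r))) (hT r⁻¹ (inv_ne_zero hr)) using 1
    ext i j
    fin_cases i <;> fin_cases j <;> simp [Matrix.mul_apply, Fin.sum_univ_three, hr]
    all_goals field_simp
  have h31 : ∀ e : F, !![1, 0, 0; 0, 1, 0; e, 0, 1] ∈ S := by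
    intro e
    convert S.mul_mem (hrow s (e / (d * (s - 1))) hs0)
      (hrow 1 (-(e / (d * (s - 1)))) one_ne_zero) using 1
    ext i j
    fin_cases i <;> fin_cases j <;> simp [Matrix.mul_apply, Fin.sum_univ_three]
    field_simp
    ring
  have h32 : ∀ e : F, !![1, 0, 0; 0, 1, 0; 0, e, 1] ∈ S := by
    intro e
    convert S.mul_mem (hrow 1 (-e / b) one_ne_zero) (h31 (e * d / b)) using 1
    ext i j
    fin_cases i <;> fin_cases j <;> simp [Matrix.mul_apply, Fin.sum_univ_three, hb]
    field_simp
    ring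
  have h13 : ∀ e : F, !![1, 0, e; 0, 1, 0; 0, 0, 1] ∈ S := by
    intro e
    convert S.mul_mem (hcol s (e / (a * (s - 1))) hs0)
      (hcol 1 (-(e / (a * (s - 1)))) one_ne_zero) using 1
    ext i j
    fin_cases i <;> fin_cases j <;> simp [Matrix.mul_apply, Fin.sum_univ_three]
    field_simp
    ring
  have h23 : ∀ e : F, !![1, 0, 0; 0, 1, e; 0, 0, 1] ∈ S := by
    intro e
    convert S.mul_mem (hcol 1 (e / c) one_ne_zero) (h13 (-e * a / c)) using 1
    ext i j
    fin_cases i <;> fin_cases j <;> simp [Matrix.mul_apply, Fin.sum_univ_three, hc]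
    field_simp
    ring
  have key : ∀ M ∈ S, transvection i j e = M → transvection i j e ∈ S := fun M hM h => h ▸ hM
  fin_cases i <;> fin_cases j <;> first | exact absurd rfl hij | skip
  · refine key _ (hblock e).1 ?_
    ext k l
    fin_cases k <;> fin_cases l <;> simp [transvection]
  · refine key _ (h13 e) ?_
    ext k l
    fin_cases k <;> fin_cases l <;> simp [transvection]
  · refine key _ (hblock e).2 ?_
    ext k l
    fin_cases k <;> fin_cases l <;> simp [transvection]
  · refine key _ (h23 e) ?_
    ext k l
    fin_cases k <;> fin_cases l <;> simp [transvection]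
  · refine key _ (h31 e) ?_
    ext k l
    fin_cases k <;> fin_cases l <;> simp [transvection]
  · refine key _ (h32 e) ?_
    ext k l
    fin_cases k <;> fin_cases l <;> simp [transvection]

end

/-- Over a field with at least six elements, the parameters required in
`block_transvection_mem` exist. -/
theorem exists_generic_parameters [Fintype F] (hF : 6 ≤ Fintype.card F) (u v : F) :
    ∃ a b : F, a ≠ 0 ∧ a - 1 ≠ 0 ∧ b ≠ 0 ∧ b - 1 ≠ 0 ∧ b - a ≠ 0 ∧ a * b - 1 ≠ 0 ∧
      1 + (a - 1) * v ≠ 0 ∧ 1 + (b - 1) * u ≠ 0 := by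
  classical
  have hne : ∀ a v : F, a ≠ 1 - v⁻¹ → 1 + (a - 1) * v ≠ 0 := by
    intro a v ha h
    have hv : v ≠ 0 := by
      rintro rfl
      simp at h
    refine ha ?_
    field_simp
    linear_combination h
  obtain ⟨a, -, ha⟩ := Finset.exists_mem_notMem_of_card_lt_card (s := ({0, 1, 1 - v⁻¹} : Finset F))
    (t := Finset.univ) (Finset.card_le_three.trans_lt (by rw [Finset.card_univ]; lia))
  obtain ⟨b, -, hb⟩ := Finset.exists_mem_notMem_of_card_lt_card
    (s := ({0, 1, 1 - u⁻¹, a, a⁻¹} : Finset F))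
    (t := Finset.univ) (Finset.card_le_five.trans_lt (by rw [Finset.card_univ]; lia))
  simp only [Finset.mem_insert, Finset.mem_singleton, not_or] at ha hb
  obtain ⟨ha0, ha1, hav⟩ := ha
  obtain ⟨hb0, hb1, hbu, hba, hba'⟩ := hb
  exact ⟨a, b, ha0, sub_ne_zero.2 ha1, hb0, sub_ne_zero.2 hb1, sub_ne_zero.2 hba,
    fun h => hba' (eq_inv_of_mul_eq_one_right (sub_eq_zero.1 h)), hne a v hav, hne b u hbu⟩

/-- If the powers of `-q` exhaust the nonzero elements of a field with at least six elements, then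
the Burau matrices at `q` generate the special linear group. -/
theorem closure_Xmat_Ymat_eq_top [Fintype F] (hF : 6 ≤ Fintype.card F) {q : F} (hq : q ≠ 0)
    (hq2 : q ^ 2 ≠ 1) (hq3 : q ^ 3 ≠ -1) (hq4 : q ^ 4 ≠ 1)
    (hgen : ∀ s : F, s ≠ 0 → ∃ k : ℕ, (-q) ^ k = s)
    {X Y : SpecialLinearGroup (Fin 3) F} (hX : (X : Matrix (Fin 3) (Fin 3) F) = Xmat q)
    (hY : (Y : Matrix (Fin 3) (Fin 3) F) = Ymat q) : Subgroup.closure {X, Y} = ⊤ := by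
  have hq1 : q + 1 ≠ 0 := fun h => hq2 (by linear_combination (q - 1) * h)
  have hn : q - 1 ≠ 0 := fun h => hq2 (by linear_combination (q + 1) * h)
  have hi : 1 + q ^ 2 ≠ 0 := fun h => hq4 (by linear_combination (q ^ 2 - 1) * h)
  have hm : q ^ 2 - q + 1 ≠ 0 := fun h => hq3 (by linear_combination (q + 1) * h)
  let B : Matrix (Fin 3) (Fin 3) F := !![1, 1, 0; q, q - q ^ 2, 1; 0, q, 1]
  let C : Matrix (Fin 3) (Fin 3) F :=
    !![q / (q + 1), (q * (q + 1))⁻¹, -(q * (q + 1))⁻¹;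
      (q + 1)⁻¹, -(q * (q + 1))⁻¹, (q * (q + 1))⁻¹;
      -q / (q + 1), (q + 1)⁻¹, q / (q + 1)]
  have hCB : C * B = 1 := by
    ext i j
    fin_cases i <;> fin_cases j <;> simp [B, C, Matrix.mul_apply, Fin.sum_univ_three] <;>
      field_simp <;> ring
  have hBC : B * C = 1 := mul_eq_one_comm.1 hCB
  let S : Submonoid (Matrix (Fin 3) (Fin 3) F) :=
    { carrier := {M | ∃ A ∈ Subgroup.closure {X, Y}, (A : Matrix (Fin 3) (Fin 3) F) = B * M * C}
      one_mem' := ⟨1, one_mem _, by simp [hBC]⟩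
      mul_mem' := by
        rintro M N ⟨A, hA, hAM⟩ ⟨A', hA', hAN⟩
        refine ⟨A * A', mul_mem hA hA', (Matrix.SpecialLinearGroup.coe_mul A A').trans ?_⟩
        rw [hAM, hAN]
        calc B * M * C * (B * N * C) = B * M * (C * B) * N * C := by simp only [Matrix.mul_assoc]
          _ = B * (M * N) * C := by simp only [hCB, Matrix.mul_assoc, Matrix.one_mul] }
  have hinv : ∀ M N : Matrix (Fin 3) (Fin 3) F, M * N = 1 → M ∈ S → N ∈ S := by
    rintro M N hMN ⟨A, hA, hAM⟩
    refine ⟨A⁻¹, inv_mem hA, ?_⟩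
    have h1 : ((A⁻¹ : SpecialLinearGroup (Fin 3) F) : Matrix (Fin 3) (Fin 3) F) *
        (A : Matrix (Fin 3) (Fin 3) F) = 1 :=
      (Matrix.SpecialLinearGroup.coe_mul A⁻¹ A).symm.trans (congrArg Subtype.val (inv_mul_cancel A))
    have h2 : (A : Matrix (Fin 3) (Fin 3) F) * (B * N * C) = 1 := by
      calc (A : Matrix (Fin 3) (Fin 3) F) * (B * N * C) = B * M * (C * B) * N * C := by
            rw [hAM]
            simp only [Matrix.mul_assoc]
        _ = B * (M * N) * C := by simp only [hCB, Matrix.mul_assoc, Matrix.one_mul]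
        _ = 1 := by rw [hMN, Matrix.mul_one, hBC]
    exact left_inv_eq_right_inv h1 h2
  have hYS : !![-q, 0, 0; 0, 1, 0; 0, 0, (-q)⁻¹] ∈ S := by
    refine ⟨Y, Subgroup.subset_closure (by simp), ?_⟩
    rw [hY]
    ext i j
    fin_cases i <;> fin_cases j <;>
      simp [Ymat, B, C, Matrix.mul_apply, Fin.sum_univ_three] <;> field_simp <;> ring
  have hXS : !![0, -((q - 1) * (1 + q ^ 2) / q), (q ^ 2 - q + 1) / q ^ 2;
      0, -((q ^ 2 - q + 1) / q), (q - 1) / q ^ 2; q, 0, 0] ∈ S := by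
    refine ⟨X, Subgroup.subset_closure (by simp), ?_⟩
    rw [hX]
    ext i j
    fin_cases i <;> fin_cases j <;>
      simp [Xmat, B, C, Matrix.mul_apply, Fin.sum_univ_three] <;> field_simp <;> ring
  have hT : ∀ s : F, s ≠ 0 → !![s, 0, 0; 0, 1, 0; 0, 0, s⁻¹] ∈ S := by
    intro s hs
    obtain ⟨k, rfl⟩ := hgen s hs
    clear hs
    induction k with
    | zero =>
      convert S.one_mem using 1
      ext i j
      fin_cases i <;> fin_cases j <;> simp
    | succ k ih =>
      convert S.mul_mem ih hYS using 1
      ext i j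
      fin_cases i <;> fin_cases j <;> simp [Matrix.mul_apply, Fin.sum_univ_three, pow_succ]
      field_simp
  obtain ⟨s, t, hs0, hs1, ht0, ht1, hst, hst', hsv, htu⟩ := exists_generic_parameters hF
    (q * -((q - 1) * (1 + q ^ 2) / q) * ((q - 1) / q ^ 2))
    (-(q * ((q ^ 2 - q + 1) / q ^ 2) * -((q ^ 2 - q + 1) / q)))
  have hall := mem_of_forall_transvection_mem S (forall_transvection_mem S hinv hT
    (neg_ne_zero.2 (div_ne_zero (mul_ne_zero hn hi) hq)) (div_ne_zero hm (pow_ne_zero 2 hq))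
    (neg_ne_zero.2 (div_ne_zero hm hq)) (div_ne_zero hn (pow_ne_zero 2 hq))
    (by field_simp; ring) hXS hs0 hs1 ht0 ht1 hst hst' hsv htu)
  refine (Subgroup.eq_top_iff' _).2 fun A => ?_
  have hdet : (C * (A : Matrix (Fin 3) (Fin 3) F) * B).det = 1 := by
    rw [det_mul, det_mul, A.det_coe, mul_one, ← det_mul, hCB, det_one]
  obtain ⟨A', hA', h⟩ := hall ⟨_, hdet⟩
  convert hA'
  apply Subtype.ext
  change (A : Matrix (Fin 3) (Fin 3) F) = A'
  rw [h]
  calc (A : Matrix (Fin 3) (Fin 3) F) = (B * C) * A * (B * C) := by simp [hBC]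
    _ = B * (C * A * B) * C := by simp only [Matrix.mul_assoc]

end Generation

/-- For every finite field `k₀` with `|k₀| = Q ∉ {2,3,4,5,7}` there is a unit `t ∈ k₀` with
`t⁴ ≠ 1` such that `X(t)` and `Y(t)` have determinant 1 and generate `SL₃(k₀)`. -/
theorem sl3_generated_by_burau_specialization (k₀ : Type) [Field k₀] [Fintype k₀]
    (hQ : Fintype.card k₀ ∉ ({2, 3, 4, 5, 7} : Set ℕ)) :
    ∃ t : k₀, t ≠ 0 ∧ t ^ 4 ≠ 1 ∧
      ∃ X' Y' : Matrix.SpecialLinearGroup (Fin 3) k₀,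
        (X' : Matrix (Fin 3) (Fin 3) k₀) = Xmat t ∧
        (Y' : Matrix (Fin 3) (Fin 3) k₀) = Ymat t ∧
        Subgroup.closure {X', Y'} = ⊤ := by
  classical
  have hF : 6 ≤ Fintype.card k₀ := by
    have := Fintype.one_lt_card (α := k₀)
    simp only [Set.mem_insert_iff, Set.mem_singleton_iff, not_or] at hQ
    lia
  obtain ⟨g, hg⟩ := IsCyclic.exists_generator (α := k₀ˣ)
  have hord : orderOf g = Fintype.card k₀ - 1 := by
    rw [orderOf_eq_card_of_forall_mem_zpowers hg, Nat.card_eq_fintype_card, Fintype.card_units]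
  have hpow : ∀ k, k ≠ 0 → k < 5 → (g : k₀) ^ k ≠ 1 := by
    intro k hk0 hk h
    have : g ^ k = 1 := Units.ext (by simpa using h)
    have := Nat.le_of_dvd (Nat.pos_of_ne_zero hk0) (orderOf_dvd_of_pow_eq_one this)
    lia
  have hg0 : -(g : k₀) ≠ 0 := neg_ne_zero.2 g.ne_zero
  have h4 : (-(g : k₀)) ^ 4 ≠ 1 := by
    rw [Even.neg_pow (by decide)]
    exact hpow 4 (by simp) (by simp)
  refine ⟨-g, hg0, h4, ⟨_, det_Xmat hg0⟩, ⟨_, det_Ymat hg0⟩, rfl, rfl,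
    closure_Xmat_Ymat_eq_top hF hg0 ?_ ?_ h4 ?_ rfl rfl⟩
  · rw [Even.neg_pow (by decide)]
    exact hpow 2 (by simp) (by simp)
  · rw [Odd.neg_pow (by decide), neg_inj.ne]
    exact hpow 3 (by simp) (by simp)
  · intro s hs
    obtain ⟨k, hk⟩ := (mem_powers_iff_mem_zpowers (x := g)).2 (hg (Units.mk0 s hs))
    refine ⟨k, ?_⟩
    rw [neg_neg, ← Units.val_pow_eq_pow_val]
    exact congrArg Units.val hk
end

section
/- Let k be an integral domain. Define maps R, S, T : k³ → k³ by R(x, y, z) := (x, y, xy − z), S(x, y, z) := (y, x, z), T(x, y, z) := (x, z, y), and let V be the group of four bijections of k³ consisting of the identity and the three sign changes (x, y, z) ↦ (−x, −y, z), (x, y, z) ↦ (−x, y, −z), (x, y, z) ↦ (x, −y, −z). Then each of R, S, T maps every V-orbit in k³ onto a V-orbit, so they induce maps on the orbit set k³/V; and a V-orbit is fixed by all three induced maps if and only if it is the V-orbit of (0, 0, 0) or the V-orbit of (2, 2, 2). -/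
/-- The automorphism `R : (x, y, z) ↦ (x, y, xy - z)` of Fricke coordinates. -/
def Rmap {k : Type*} [CommRing k] (p : k × k × k) : k × k × k :=
  (p.1, p.2.1, p.1 * p.2.1 - p.2.2)

/-- The automorphism `S : (x, y, z) ↦ (y, x, z)`. -/
def Smap {k : Type*} [CommRing k] (p : k × k × k) : k × k × k :=
  (p.2.1, p.1, p.2.2)

/-- The automorphism `T : (x, y, z) ↦ (x, z, y)`. -/
def Tmap {k : Type*} [CommRing k] (p : k × k × k) : k × k × k :=
  (p.1, p.2.2, p.2.1)

/-- The sign change `(x, y, z) ↦ (-x, -y, z)`. -/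
def sgn12 (k : Type*) [CommRing k] : Equiv.Perm (k × k × k) :=
  Function.Involutive.toPerm (fun p => (-p.1, -p.2.1, p.2.2)) (by intro p; simp)

/-- The sign change `(x, y, z) ↦ (-x, y, -z)`. -/
def sgn13 (k : Type*) [CommRing k] : Equiv.Perm (k × k × k) :=
  Function.Involutive.toPerm (fun p => (-p.1, p.2.1, -p.2.2)) (by intro p; simp)

/-- The sign change `(x, y, z) ↦ (x, -y, -z)`. -/
def sgn23 (k : Type*) [CommRing k] : Equiv.Perm (k × k × k) :=
  Function.Involutive.toPerm (fun p => (p.1, -p.2.1, -p.2.2)) (by intro p; simp)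

/-- The Klein four-group `V` of sign changes (the group generated by the three sign
changes; it consists of the identity and the three sign changes). -/
def Vgrp (k : Type*) [CommRing k] : Subgroup (Equiv.Perm (k × k × k)) :=
  Subgroup.closure {sgn12 k, sgn13 k, sgn23 k}

theorem mem_orbit_Vgrp_iff {k : Type*} [CommRing k] {x y z a b c : k} :
    (a, b, c) ∈ MulAction.orbit (Vgrp k) (x, y, z) ↔
      (a = x ∧ b = y ∧ c = z) ∨ (a = -x ∧ b = -y ∧ c = z) ∨
      (a = -x ∧ b = y ∧ c = -z) ∨ (a = x ∧ b = -y ∧ c = -z) := by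
  constructor
  · suffices h : ∀ g ∈ Vgrp k, ∀ p : k × k × k,
        ((g p).1 = p.1 ∧ (g p).2.1 = p.2.1 ∧ (g p).2.2 = p.2.2) ∨
        ((g p).1 = -p.1 ∧ (g p).2.1 = -p.2.1 ∧ (g p).2.2 = p.2.2) ∨
        ((g p).1 = -p.1 ∧ (g p).2.1 = p.2.1 ∧ (g p).2.2 = -p.2.2) ∨
        ((g p).1 = p.1 ∧ (g p).2.1 = -p.2.1 ∧ (g p).2.2 = -p.2.2) by
      rintro ⟨⟨g, hg⟩, hgp⟩
      have hgp' : g (x, y, z) = (a, b, c) := hgp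
      simpa only [hgp'] using h g hg (x, y, z)
    intro g hg
    induction hg using Subgroup.closure_induction with
    | mem g hg =>
      intro p
      rcases hg with rfl | rfl | rfl
      · exact Or.inr (Or.inl ⟨rfl, rfl, rfl⟩)
      · exact Or.inr (Or.inr (Or.inl ⟨rfl, rfl, rfl⟩))
      · exact Or.inr (Or.inr (Or.inr ⟨rfl, rfl, rfl⟩))
    | one => exact fun p => Or.inl ⟨rfl, rfl, rfl⟩
    | mul g h _ _ ihg ihh =>
      intro p
      have hg := ihg (h p)
      have hh := ihh p
      rw [Equiv.Perm.mul_apply]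
      grind
    | inv g _ ih =>
      intro p
      have hg := ih (g⁻¹ p)
      rw [← Equiv.Perm.mul_apply, mul_inv_cancel, Equiv.Perm.one_apply] at hg
      grind
  · rintro (⟨rfl, rfl, rfl⟩ | ⟨rfl, rfl, rfl⟩ | ⟨rfl, rfl, rfl⟩ | ⟨rfl, rfl, rfl⟩)
    · exact MulAction.mem_orbit_self _
    · exact ⟨⟨sgn12 k, Subgroup.subset_closure (by simp)⟩, rfl⟩
    · exact ⟨⟨sgn13 k, Subgroup.subset_closure (by simp)⟩, rfl⟩
    · exact ⟨⟨sgn23 k, Subgroup.subset_closure (by simp)⟩, rfl⟩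

theorem Function.Involutive.image_orbit_eq {G α : Type*} [Group G] [MulAction G α] {f : α → α}
    (hf : Function.Involutive f)
    (h : ∀ p, ∀ q ∈ MulAction.orbit G p, f q ∈ MulAction.orbit G (f p)) (p : α) :
    f '' MulAction.orbit G p = MulAction.orbit G (f p) := by
  refine Set.Subset.antisymm (Set.image_subset_iff.2 (h p)) fun q hq => ⟨f q, ?_, hf q⟩
  simpa only [hf p] using h (f p) q hq

theorem Rmap_image_orbit {k : Type*} [CommRing k] (p : k × k × k) :
    Rmap '' MulAction.orbit (Vgrp k) p = MulAction.orbit (Vgrp k) (Rmap p) := by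
  refine Function.Involutive.image_orbit_eq (fun p => by simp [Rmap]) ?_ p
  rintro ⟨x, y, z⟩ ⟨a, b, c⟩ h
  simp only [Rmap, mem_orbit_Vgrp_iff] at h ⊢
  grind

theorem Smap_image_orbit {k : Type*} [CommRing k] (p : k × k × k) :
    Smap '' MulAction.orbit (Vgrp k) p = MulAction.orbit (Vgrp k) (Smap p) := by
  refine Function.Involutive.image_orbit_eq (fun p => by simp [Smap]) ?_ p
  rintro ⟨x, y, z⟩ ⟨a, b, c⟩ h
  simp only [Smap, mem_orbit_Vgrp_iff] at h ⊢
  tauto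

theorem Tmap_image_orbit {k : Type*} [CommRing k] (p : k × k × k) :
    Tmap '' MulAction.orbit (Vgrp k) p = MulAction.orbit (Vgrp k) (Tmap p) := by
  refine Function.Involutive.image_orbit_eq (fun p => by simp [Tmap]) ?_ p
  rintro ⟨x, y, z⟩ ⟨a, b, c⟩ h
  simp only [Tmap, mem_orbit_Vgrp_iff] at h ⊢
  tauto

/-- Over an integral domain `k`, the maps `R`, `S`, `T` send `V`-orbits in `k³` onto
`V`-orbits, and a `V`-orbit is fixed by all three induced maps on `k³/V` if and only if it
is the orbit of `(0,0,0)` or of `(2,2,2)`. -/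
theorem fricke_action_fixed_orbits (k : Type) [CommRing k] [IsDomain k] :
    (∀ p : k × k × k,
      Rmap '' MulAction.orbit (Vgrp k) p = MulAction.orbit (Vgrp k) (Rmap p) ∧
      Smap '' MulAction.orbit (Vgrp k) p = MulAction.orbit (Vgrp k) (Smap p) ∧
      Tmap '' MulAction.orbit (Vgrp k) p = MulAction.orbit (Vgrp k) (Tmap p)) ∧
    (∀ p : k × k × k,
      (Rmap '' MulAction.orbit (Vgrp k) p = MulAction.orbit (Vgrp k) p ∧
       Smap '' MulAction.orbit (Vgrp k) p = MulAction.orbit (Vgrp k) p ∧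
       Tmap '' MulAction.orbit (Vgrp k) p = MulAction.orbit (Vgrp k) p) ↔
      (MulAction.orbit (Vgrp k) p = MulAction.orbit (Vgrp k) ((0 : k), (0 : k), (0 : k)) ∨
       MulAction.orbit (Vgrp k) p = MulAction.orbit (Vgrp k) ((2 : k), (2 : k), (2 : k)))) := by
  refine ⟨fun p => ⟨Rmap_image_orbit p, Smap_image_orbit p, Tmap_image_orbit p⟩, ?_⟩
  rintro ⟨x, y, z⟩
  rw [Rmap_image_orbit, Smap_image_orbit, Tmap_image_orbit]
  simp only [MulAction.orbit_eq_iff, Rmap, Smap, Tmap, mem_orbit_Vgrp_iff]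
  constructor
  · rintro ⟨hR, hS, hT⟩
    have hy : y = x ∨ y = -x := by tauto
    have hz : z = y ∨ z = -y := by tauto
    have hR' : x * y = 2 * z ∨ x * y = 0 := by grind
    have hx : x = 0 ∨ x = 2 ∨ x = -2 := by
      by_cases hx : x = 0
      · exact Or.inl hx
      · have h : x * (x - 2) = 0 ∨ x * (x + 2) = 0 := by grind
        simp only [mul_eq_zero, hx, false_or] at h
        grind
    by_cases h2 : (2 : k) = 0
    · grind
    · have h8 : (2 : k) * (2 * 2) ≠ 0 := mul_ne_zero h2 (mul_ne_zero h2 h2)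
      have hxyz : x * y = 2 * z := by grind
      rcases hx with rfl | rfl | rfl <;> rcases hy with rfl | rfl <;>
        rcases hz with rfl | rfl <;>
        first
        | (simp; done)
        | exact absurd (by linear_combination hxyz) h8
        | exact absurd (by linear_combination -hxyz) h8
  · rintro (h | h) <;> grind
end
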